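/- arXiv:1605.00903 — 3 statements merged into one kernel-verified Lean document; each statement's English description precedes it below -/
import Mathlib

section
/- Let n ≥ 1, d ≥ 1 and q = 2^k·d for some integer k ≥ 1. Let f be a homogeneous polynomial of degree d in x_1,…,x_n, let M ∈ ℝ^{[n]^{q/2}×[n]^{q/2}} be a symmetric matrix representation of f^{q/d}, and let Ẽ be a degree-q sphere pseudo-expectation. Then λ_max(M) := sup_{‖y‖₂=1} yᵀMy is nonnegative and Ẽ(f) ≤ (λ_max(M))^{d/q}. -/
open scoped BigOperators

noncomputable section

/-- The ±1-valued tensor associated with a Boolean sign pattern. -/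
def signT {n d : ℕ} (A : (Fin d → Fin n) → Bool) : (Fin d → Fin n) → ℝ :=
  fun K => if A K then 1 else -1

/-- Expectation of `g` over a random order-`d` tensor with i.i.d. uniform ±1 entries. -/
def texp (n d : ℕ) (g : ((Fin d → Fin n) → ℝ) → ℝ) : ℝ :=
  (∑ A : (Fin d → Fin n) → Bool, g (signT A)) / (Fintype.card ((Fin d → Fin n) → Bool) : ℝ)

/-- Probability of event `P` over a random order-`d` tensor with i.i.d. uniform ±1 entries. -/
def tprob (n d : ℕ) (P : ((Fin d → Fin n) → ℝ) → Prop) : ℝ :=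
  (Nat.card {A : (Fin d → Fin n) → Bool // P (signT A)} : ℝ) /
    (Fintype.card ((Fin d → Fin n) → Bool) : ℝ)

/-- Operator (ℓ₂→ℓ₂) norm of a rectangular array, as the sup of `|uᵀ M v|` over unit vectors. -/
def opNorm {ι κ : Type*} [Fintype ι] [Fintype κ] (M : ι → κ → ℝ) : ℝ :=
  sSup {r : ℝ | ∃ (u : EuclideanSpace ℝ ι) (v : EuclideanSpace ℝ κ),
    ‖u‖ = 1 ∧ ‖v‖ = 1 ∧ r = |∑ i, ∑ j, u i * M i j * v j|}

/-- Largest eigenvalue of a symmetric array, as the sup of Rayleigh quotients. -/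
def lamMax {ι : Type*} [Fintype ι] (M : ι → ι → ℝ) : ℝ :=
  sSup {r : ℝ | ∃ y : EuclideanSpace ℝ ι, ‖y‖ = 1 ∧ r = ∑ i, ∑ j, y i * M i j * y j}

/-- Number of occurrences of `v` among the coordinates of the tuple `I`. -/
def cnt {n k : ℕ} (I : Fin k → Fin n) (v : Fin n) : ℕ :=
  (Finset.univ.filter fun ℓ => I ℓ = v).card

/-- The set `O(δ)` of tuples whose multi-index is `δ`. -/
def Oset (n k : ℕ) (δ : Fin n → ℕ) : Finset (Fin k → Fin n) :=
  Finset.univ.filter fun K => ∀ v, cnt K v = δ v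

/-- The set of elements of `[n]` occurring among the coordinates of `I¹, …, Iᵖ`. -/
def occSet {n h p : ℕ} (I : Fin p → Fin h → Fin n) : Finset (Fin n) :=
  Finset.univ.filter fun v => ∃ ℓ j, I ℓ j = v

/-- Membership in the class `𝒞(c¹,…,cˢ)`: there are exactly `s` distinct occurring
elements and the `k`-th smallest occurring element appears `c k ℓ` times in `Iˡ`. -/
def inC {n h p s : ℕ} (c : Fin s → Fin p → ℕ) (I : Fin p → Fin h → Fin n) : Prop :=
  ∃ hcard : (occSet I).card = s,
    ∀ (k : Fin s) (ℓ : Fin p),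
      cnt (I ℓ) (((occSet I).orderIsoOfFin hcard k : Fin n)) = c k ℓ

/-- Concatenation of two half-tuples of length `d/2` into a tuple of length `d` (`d` even). -/
def halfConcat {n : ℕ} (d : ℕ) (hd : d % 2 = 0) (K₁ K₂ : Fin (d / 2) → Fin n) :
    Fin d → Fin n :=
  fun t => if h : (t : ℕ) < d / 2 then K₁ ⟨t, h⟩
           else K₂ ⟨(t : ℕ) - d / 2, by have ht := t.isLt; omega⟩

/-- The position in `[q/2]` of the `r`-th entry of the `m`-th block of length `d/2`. -/
def blockIdx (d q : ℕ) (m : Fin (q / d)) (r : Fin (d / 2)) : Fin (q / 2) :=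
  ⟨(m : ℕ) * (d / 2) + (r : ℕ), by
    have hm : (m : ℕ) < q / d := m.isLt
    have hr : (r : ℕ) < d / 2 := r.isLt
    have h3 : q / d * (d / 2) ≤ q / 2 := by
      have h4 : q / d * d ≤ q := Nat.div_mul_le_self q d
      have h6 : q / d * (d / 2) * 2 ≤ q / d * d := by
        have h5 : d / 2 * 2 ≤ d := by omega
        calc q / d * (d / 2) * 2 = q / d * (d / 2 * 2) := by ring
          _ ≤ q / d * d := Nat.mul_le_mul (le_refl _) h5
      omega
    have h7 : ((m : ℕ) + 1) * (d / 2) ≤ q / d * (d / 2) :=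
      Nat.mul_le_mul (by omega) (le_refl _)
    have h8 : ((m : ℕ) + 1) * (d / 2) = (m : ℕ) * (d / 2) + d / 2 := by ring
    omega⟩

/-- Row-column independent symmetrization of `A^{⊗ q/d}`. -/
def rcSym (n d q : ℕ) (hd : d % 2 = 0) (A : (Fin d → Fin n) → ℝ)
    (I J : Fin (q / 2) → Fin n) : ℝ :=
  ((Nat.factorial (q / 2) : ℝ))⁻¹ ^ 2 *
    ∑ π : Equiv.Perm (Fin (q / 2)), ∑ σ : Equiv.Perm (Fin (q / 2)),
      ∏ m : Fin (q / d),
        A (halfConcat d hd (fun r => I (π (blockIdx d q m r)))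
            (fun r => J (σ (blockIdx d q m r))))

/-- `E(I¹,…,Iᵖ) = 𝔼[∏_ℓ M[Iˡ, Iˡ⁺¹]]` (cyclically). -/
def Efun (n d q p : ℕ) (hd : d % 2 = 0) (hp : p ≠ 0)
    (I : Fin p → Fin (q / 2) → Fin n) : ℝ :=
  haveI : NeZero p := ⟨hp⟩
  texp n d fun A => ∏ ℓ : Fin p, rcSym n d q hd A (I ℓ) (I (ℓ + 1))

/-- `Tr(M^p)` for the row-column independent symmetrization `M` of `A^{⊗ q/d}`. -/
def trMpow (n d q p : ℕ) (hd : d % 2 = 0) (hp : p ≠ 0)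
    (A : (Fin d → Fin n) → ℝ) : ℝ :=
  haveI : NeZero p := ⟨hp⟩
  ∑ I : Fin p → Fin (q / 2) → Fin n, ∏ ℓ : Fin p, rcSym n d q hd A (I ℓ) (I (ℓ + 1))

/-- `𝒯 = Σ_ℓ T_ℓ ⊗ T_ℓ`, where `T_ℓ` is the symmetrized `ℓ`-th slice of the 3-tensor `A`. -/
def calT (n : ℕ) (A : (Fin 3 → Fin n) → ℝ) (u v : Fin n × Fin n) : ℝ :=
  ∑ ℓ : Fin n,
    ((A ![ℓ, u.1, v.1] + A ![ℓ, v.1, u.1]) / 2) *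
    ((A ![ℓ, u.2, v.2] + A ![ℓ, v.2, u.2]) / 2)

/-- `T = 𝒯 - D`, where `D` is the restriction of `𝒯` to entries `[(i,i),(j,j)]`. -/
def Tmat (n : ℕ) (A : (Fin 3 → Fin n) → ℝ) (u v : Fin n × Fin n) : ℝ :=
  calT n A u v - (if u.1 = u.2 ∧ v.1 = v.2 then calT n A u v else 0)

/-- The position in `[q/2]` of the `r`-th entry of the `g`-th pair. -/
def pairIdx (q : ℕ) (g : Fin (q / 4)) (r : Fin 2) : Fin (q / 2) :=
  ⟨2 * (g : ℕ) + (r : ℕ), by have hg := g.isLt; have hr := r.isLt; omega⟩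

/-- `𝖠 = T^{⊗ q/4}` as a `[n]^{q/2} × [n]^{q/2}` array. -/
def bigA3 (n q : ℕ) (A : (Fin 3 → Fin n) → ℝ) (I J : Fin (q / 2) → Fin n) : ℝ :=
  ∏ g : Fin (q / 4),
    Tmat n A (I (pairIdx q g 0), I (pairIdx q g 1)) (J (pairIdx q g 0), J (pairIdx q g 1))

/-- The row-column symmetrized matrix `B`. -/
def Bmat (n q : ℕ) (A : (Fin 3 → Fin n) → ℝ) (I J : Fin (q / 2) → Fin n) : ℝ :=
  ((Nat.factorial (q / 2) : ℝ))⁻¹ ^ 2 *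
    ∑ π : Equiv.Perm (Fin (q / 2)), ∑ σ : Equiv.Perm (Fin (q / 2)),
      bigA3 n q A (fun t => I (π t)) (fun t => J (σ t))

/-- `E(I¹,…,Iᵖ) = 𝔼[∏_ℓ B[Iˡ, Iˡ⁺¹]]` (cyclically), for the 3-tensor case. -/
def E3fun (n q p : ℕ) (hp : p ≠ 0) (I : Fin p → Fin (q / 2) → Fin n) : ℝ :=
  haveI : NeZero p := ⟨hp⟩
  texp n 3 fun A => ∏ ℓ : Fin p, Bmat n q A (I ℓ) (I (ℓ + 1))

/-- Concatenation of two tuples of length `q/2` into a tuple of length `q` (`q` even). -/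
def tupConcat {n : ℕ} (q : ℕ) (hq : q % 2 = 0) (I J : Fin (q / 2) → Fin n) :
    Fin q → Fin n :=
  fun t => if h : (t : ℕ) < q / 2 then I ⟨t, h⟩
           else J ⟨(t : ℕ) - q / 2, by have ht := t.isLt; omega⟩

end

theorem aux_sphere (n m : ℕ) (E : MvPolynomial (Fin n) ℝ →ₗ[ℝ] ℝ)
    (hE1 : E 1 = 1)
    (hEs : ∀ p : MvPolynomial (Fin n) ℝ, p.totalDegree ≤ 2 * m - 2 →
      E (p * ((∑ i, MvPolynomial.X i ^ 2) - 1)) = 0) :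
    ∀ j, j ≤ m → E ((∑ i, MvPolynomial.X i ^ 2) ^ j) = 1 := by
  intro j
  induction j with
  | zero => intro _; simpa using hE1
  | succ j ih =>
    intro hj
    have h := hEs ((∑ i, MvPolynomial.X i ^ 2) ^ j) (by
      refine (MvPolynomial.totalDegree_pow _ _).trans ?_
      have : (∑ i : Fin n, (MvPolynomial.X i : MvPolynomial (Fin n) ℝ) ^ 2).totalDegree ≤ 2 := by
        refine MvPolynomial.totalDegree_finsetSum_le ?_
        intro i _
        refine (MvPolynomial.totalDegree_pow _ _).trans ?_
        simp
      calc _ ≤ j * 2 := Nat.mul_le_mul le_rfl this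
        _ ≤ _ := by omega)
    rw [mul_sub, map_sub, mul_one, ih (by omega), ← pow_succ] at h
    linarith

theorem aux_sq (n m : ℕ) (E : MvPolynomial (Fin n) ℝ →ₗ[ℝ] ℝ)
    (hE1 : E 1 = 1)
    (hEsq : ∀ p : MvPolynomial (Fin n) ℝ, p.totalDegree ≤ m → 0 ≤ E (p * p))
    (g : MvPolynomial (Fin n) ℝ) (hg : g.totalDegree ≤ m) : E g ^ 2 ≤ E (g ^ 2) := by
  have h := hEsq (g - MvPolynomial.C (E g)) (by
    refine (MvPolynomial.totalDegree_sub _ _).trans ?_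
    simpa using hg)
  have e : (g - MvPolynomial.C (E g)) * (g - MvPolynomial.C (E g))
      = g ^ 2 - (2 * E g) • g + (E g ^ 2) • (1 : MvPolynomial (Fin n) ℝ) := by
    simp only [MvPolynomial.smul_eq_C_mul, map_mul, map_pow]
    have : (MvPolynomial.C (2 : ℝ) : MvPolynomial (Fin n) ℝ) = 2 := map_ofNat _ 2
    rw [this]
    ring
  rw [e, map_add, map_sub, map_smul, map_smul, hE1] at h
  simp only [smul_eq_mul] at h
  nlinarith

theorem aux_bdd {ι : Type*} [Fintype ι] (M : ι → ι → ℝ) :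
    BddAbove {r : ℝ | ∃ y : EuclideanSpace ℝ ι, ‖y‖ = 1 ∧ r = ∑ i, ∑ j, y i * M i j * y j} := by
  refine ⟨∑ i, ∑ j, |M i j|, ?_⟩
  rintro r ⟨y, hy, rfl⟩
  refine Finset.sum_le_sum fun i _ => Finset.sum_le_sum fun j _ => ?_
  refine (le_abs_self _).trans ?_
  rw [abs_mul, abs_mul]
  have hi : |y i| ≤ 1 := by simpa [hy] using PiLp.norm_apply_le y i
  have hj : |y j| ≤ 1 := by simpa [hy] using PiLp.norm_apply_le y j
  calc |y i| * |M i j| * |y j| ≤ 1 * |M i j| * 1 := by gcongr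
    _ = _ := by ring

theorem aux_quad {ι : Type*} [Fintype ι] (M : ι → ι → ℝ) (v : ι → ℝ) :
    ∑ i, ∑ j, v i * M i j * v j ≤ lamMax M * ∑ i, v i ^ 2 := by
  set y : EuclideanSpace ℝ ι := WithLp.toLp 2 v with hy
  have hn : ‖y‖ ^ 2 = ∑ i, v i ^ 2 := by
    rw [EuclideanSpace.norm_sq_eq]; simp [hy]
  by_cases h0 : ‖y‖ = 0
  · have hy0 : y = 0 := norm_eq_zero.mp h0
    have hv : ∀ i, v i = 0 := fun i => by
      have : y i = 0 := by rw [hy0]; simp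
      simpa [hy] using this
    simp [hv]
  · have hle : ∑ i, ∑ j, (‖y‖⁻¹ • y) i * M i j * (‖y‖⁻¹ • y) j ≤ lamMax M := by
      refine le_csSup (aux_bdd M) ⟨‖y‖⁻¹ • y, ?_, rfl⟩
      rw [norm_smul]; simp [h0]
    have e : ∑ i, ∑ j, (‖y‖⁻¹ • y) i * M i j * (‖y‖⁻¹ • y) j
        = (‖y‖ ^ 2)⁻¹ * ∑ i, ∑ j, v i * M i j * v j := by
      rw [Finset.mul_sum]
      refine Finset.sum_congr rfl fun i _ => ?_
      rw [Finset.mul_sum]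
      refine Finset.sum_congr rfl fun j _ => ?_
      simp [hy]
      ring
    rw [e] at hle
    have hp : 0 < ‖y‖ ^ 2 := by positivity
    rw [← hn, mul_comm]
    exact (inv_mul_le_iff₀ hp).mp hle

theorem aux_factor {ι : Type*} [Fintype ι] (M : ι → ι → ℝ)
    (hM : ∀ i j, M i j = M j i) :
    ∃ B : ι → ι → ℝ, ∀ (R : Type) [CommRing R] [Algebra ℝ R] (x : ι → R),
      algebraMap ℝ R (lamMax M) * (∑ i, x i ^ 2)
        - ∑ i, ∑ j, algebraMap ℝ R (M i j) * x i * x j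
      = ∑ l, (∑ i, algebraMap ℝ R (B l i) * x i) * (∑ i, algebraMap ℝ R (B l i) * x i) := by
  classical
  have hps : ((lamMax M) • (1 : Matrix ι ι ℝ) - Matrix.of M).PosSemidef := by
    refine Matrix.PosSemidef.of_dotProduct_mulVec_nonneg ?_ ?_
    · ext i j
      simp [Matrix.one_apply, hM i j, eq_comm]
    · intro v
      have h := aux_quad M v
      rw [Matrix.sub_mulVec, dotProduct_sub, Matrix.smul_mulVec, Matrix.one_mulVec]
      simp only [dotProduct, Matrix.mulVec, star_trivial, Matrix.of_apply, Pi.smul_apply,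
        smul_eq_mul, Finset.mul_sum] at h ⊢
      have e1 : ∑ i, v i * (lamMax M * v i) = ∑ i, lamMax M * v i ^ 2 :=
        Finset.sum_congr rfl fun i _ => by ring
      rw [e1]
      simp only [← mul_assoc]
      linarith
  open scoped MatrixOrder Matrix.Norms.L2Operator in
  obtain ⟨B, hB⟩ := CStarAlgebra.nonneg_iff_eq_star_mul_self.mp hps.nonneg
  refine ⟨B, fun R _ _ x => ?_⟩
  have hent : ∀ i j, (if i = j then lamMax M else 0) - M i j = ∑ l, B l i * B l j := by
    intro i j
    have := congrFun (congrFun hB i) j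
    simpa [Matrix.mul_apply, Matrix.one_apply, Matrix.star_apply] using this
  have e2 : algebraMap ℝ R (lamMax M) * (∑ i, x i ^ 2)
      = ∑ i, ∑ j, algebraMap ℝ R (if i = j then lamMax M else 0) * x i * x j := by
    rw [Finset.mul_sum]
    refine Finset.sum_congr rfl fun i _ => ?_
    rw [Finset.sum_eq_single i]
    · simp; ring
    · intro j _ hj; simp [Ne.symm hj]
    · simp
  rw [e2, ← Finset.sum_sub_distrib]
  simp only [← Finset.sum_sub_distrib, ← sub_mul, ← map_sub, hent, map_sum, map_mul,
    Finset.sum_mul_sum]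
  simp only [Finset.sum_mul]
  symm
  rw [Finset.sum_comm]
  refine Finset.sum_congr rfl fun i _ => ?_
  rw [Finset.sum_comm]
  refine Finset.sum_congr rfl fun j _ => Finset.sum_congr rfl fun l _ => ?_
  ring

theorem stmt_0 (n d k q : ℕ) (hn : 1 ≤ n) (hd : 1 ≤ d) (hk : 1 ≤ k)
    (hq : q = 2 ^ k * d)
    (f : MvPolynomial (Fin n) ℝ) (hf : f.IsHomogeneous d)
    (M : (Fin (q / 2) → Fin n) → (Fin (q / 2) → Fin n) → ℝ)
    (hMsymm : ∀ I J, M I J = M J I)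
    (hMrep : ∀ x : Fin n → ℝ,
      MvPolynomial.eval x (f ^ (q / d)) =
        ∑ I : Fin (q / 2) → Fin n, ∑ J : Fin (q / 2) → Fin n,
          M I J * (∏ ℓ, x (I ℓ)) * ∏ ℓ, x (J ℓ))
    (E : MvPolynomial (Fin n) ℝ →ₗ[ℝ] ℝ)
    (hE1 : E 1 = 1)
    (hEsq : ∀ p : MvPolynomial (Fin n) ℝ, p.totalDegree ≤ q / 2 → 0 ≤ E (p * p))
    (hEsphere : ∀ p : MvPolynomial (Fin n) ℝ, p.totalDegree ≤ q - 2 →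
      E (p * ((∑ i, MvPolynomial.X i ^ 2) - 1)) = 0) :
    0 ≤ lamMax M ∧ E f ≤ lamMax M ^ ((d : ℝ) / (q : ℝ)) := by
  have hN : q / d = 2 ^ k := by rw [hq]; exact Nat.mul_div_cancel _ hd
  obtain ⟨m, hm⟩ : ∃ m, q = 2 * m := by
    obtain ⟨k', rfl⟩ : ∃ k', k = k' + 1 := ⟨k - 1, by omega⟩
    exact ⟨2 ^ k' * d, by rw [hq]; ring⟩
  have hm2 : q / 2 = m := by omega
  have hnn : 0 ≤ lamMax M := by
    let x : Fin n → ℝ := Pi.single ⟨0, hn⟩ 1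
    have h1 := hMrep x
    have h2 := aux_quad M (fun I => ∏ ℓ, x (I ℓ))
    have h3 : ∑ I : Fin (q / 2) → Fin n, (∏ ℓ, x (I ℓ)) ^ 2 = 1 := by
      simp only [← Finset.prod_pow]
      rw [← Fintype.sum_pow (fun i => x i ^ 2)]
      simp [x, Pi.single_apply]
    rw [h3, mul_one] at h2
    refine le_trans ?_ h2
    have h4 : 0 ≤ MvPolynomial.eval x (f ^ (q / d)) := by
      rw [map_pow, hN]
      exact Even.pow_nonneg (by rw [Nat.even_pow]; exact ⟨even_two, by omega⟩) _
    rw [h1] at h4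
    refine h4.trans (le_of_eq ?_)
    refine Finset.sum_congr rfl fun I _ => Finset.sum_congr rfl fun J _ => ?_
    ring
  refine ⟨hnn, ?_⟩
  have hpoly : f ^ (q / d) = ∑ I : Fin (q / 2) → Fin n, ∑ J : Fin (q / 2) → Fin n,
      algebraMap ℝ (MvPolynomial (Fin n) ℝ) (M I J) * (∏ ℓ, MvPolynomial.X (I ℓ))
        * ∏ ℓ, MvPolynomial.X (J ℓ) := by
    refine MvPolynomial.funext fun x => ?_
    rw [hMrep x]
    simp [MvPolynomial.algebraMap_eq]
  obtain ⟨B, hB⟩ := aux_factor M hMsymm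
  have hB' := hB (MvPolynomial (Fin n) ℝ) (fun I => ∏ ℓ, MvPolynomial.X (I ℓ))
  rw [← hpoly] at hB'
  have hsum : ∑ I : Fin (q / 2) → Fin n, (∏ ℓ, (MvPolynomial.X (I ℓ) : MvPolynomial (Fin n) ℝ)) ^ 2
      = (∑ i, MvPolynomial.X i ^ 2) ^ (q / 2) := by
    simp only [← Finset.prod_pow]
    rw [← Fintype.sum_pow (fun i => (MvPolynomial.X i : MvPolynomial (Fin n) ℝ) ^ 2)]
  have hEN : E (f ^ (q / d)) ≤ lamMax M := by
    have h0 : 0 ≤ E (algebraMap ℝ (MvPolynomial (Fin n) ℝ) (lamMax M)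
        * (∑ I : Fin (q / 2) → Fin n, (∏ ℓ, (MvPolynomial.X (I ℓ) : MvPolynomial (Fin n) ℝ)) ^ 2)
        - f ^ (q / d)) := by
      rw [hB', map_sum]
      refine Finset.sum_nonneg fun l _ => hEsq _ ?_
      refine MvPolynomial.totalDegree_finsetSum_le fun I _ => ?_
      refine (MvPolynomial.totalDegree_mul _ _).trans ?_
      rw [MvPolynomial.algebraMap_eq, MvPolynomial.totalDegree_C, zero_add]
      refine (MvPolynomial.totalDegree_finsetProd _ _).trans ?_
      simp
    rw [hsum, map_sub, ← Algebra.smul_def, map_smul, smul_eq_mul,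
      aux_sphere n m E hE1 (by rw [← hm]; exact hEsphere) _ (le_of_eq hm2)] at h0
    linarith
  have hpow : ∀ j, j ≤ k → 1 ≤ j → E f ^ (2 ^ j) ≤ E (f ^ (2 ^ j)) := by
    intro j
    induction j with
    | zero => intro _ h; omega
    | succ j ih =>
      intro hj _
      have hdeg : (f ^ 2 ^ j).totalDegree ≤ q / 2 := by
        refine (MvPolynomial.totalDegree_pow _ _).trans ?_
        have h1 : 2 ^ j * f.totalDegree ≤ 2 ^ j * d := Nat.mul_le_mul le_rfl hf.totalDegree_le
        have h2 : 2 ^ (j + 1) * d ≤ 2 ^ k * d :=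
          Nat.mul_le_mul (Nat.pow_le_pow_right (by norm_num) hj) le_rfl
        rw [pow_succ, ← hq] at h2
        have h3 : 2 ^ j * 2 * d = 2 * (2 ^ j * d) := by ring
        omega
      have hs := aux_sq n (q / 2) E hE1 hEsq (f ^ 2 ^ j) hdeg
      rw [pow_succ, pow_mul, pow_mul]
      refine le_trans ?_ hs
      rcases Nat.eq_zero_or_pos j with rfl | hjp
      · simp
      · refine pow_le_pow_left₀ ?_ (ih (by omega) hjp) 2
        exact Even.pow_nonneg (by rw [Nat.even_pow]; exact ⟨even_two, by omega⟩) _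
  have hfin : E f ^ (2 ^ k) ≤ lamMax M := by
    refine (hpow k le_rfl hk).trans ?_
    rw [← hN]; exact hEN
  have hexp : (d : ℝ) / (q : ℝ) = ((2 ^ k : ℕ) : ℝ)⁻¹ := by
    have : (d : ℝ) ≠ 0 := by positivity
    rw [hq]; push_cast; field_simp
  rw [hexp]
  rcases le_or_gt (E f) 0 with h | h
  · exact h.trans (Real.rpow_nonneg hnn _)
  · calc E f = (E f ^ (2 ^ k)) ^ (((2 ^ k : ℕ) : ℝ)⁻¹) :=
        (Real.pow_rpow_inv_natCast h.le (by positivity)).symm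
      _ ≤ _ := Real.rpow_le_rpow (by positivity) hfin (by positivity)
end

section
/- Let d ≥ 2 be even. There exist constants C_d, c_d > 0 (depending only on d) such that for all n ≥ 3 and all even q with d | q and q ≤ n, the following holds with probability at least 1 − n^{−c_d} over the random d-tensor A with i.i.d. entries uniform on {−1,+1}: there exists a symmetric matrix M ∈ ℝ^{[n]^{q/2}×[n]^{q/2}} that is a matrix representation of the polynomial f(x)^{q/d}, where f(x) = Σ_{K∈[n]^d} A_K x^K, such that sup_{‖y‖₂=1} yᵀMy ≤ (C_d · n^{d/4} · (log n)^{d+1/2} / q^{d/4−1/2})^{q/d}. -/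
open scoped BigOperators

/-- The set of consistent pairs. -/
def QQ {V Λ : Type*} {r n : ℕ} (α β : Λ → V) (step : V → Fin (r+1)) (fl : Λ → Prop)
    (x : (V → Fin n) × Equiv.Perm V) : Prop :=
  (∀ s, step (x.2 s) = step s - 1) ∧
  ∀ i, (fl i → x.1 (x.2 (α i)) = x.1 (β i) ∧ x.1 (α i) = x.1 (x.2 (β i))) ∧
    (¬ fl i → x.1 (x.2 (α i)) = x.1 (x.2 (β i)) ∧ x.1 (α i) = x.1 (β i))

/-- Permute the old slots. -/
noncomputable def kHat {V Λ : Type*} (e : Λ ⊕ Λ ≃ V) (κ : Equiv.Perm Λ) : Equiv.Perm V :=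
  (e.symm.trans (Equiv.sumCongr (Equiv.refl Λ) κ)).trans e

lemma kHat_inl {V Λ : Type*} (e : Λ ⊕ Λ ≃ V) (κ : Equiv.Perm Λ) (i : Λ) :
    kHat e κ (e (Sum.inl i)) = e (Sum.inl i) := by simp [kHat]

lemma kHat_inr {V Λ : Type*} (e : Λ ⊕ Λ ≃ V) (κ : Equiv.Perm Λ) (i : Λ) :
    kHat e κ (e (Sum.inr i)) = e (Sum.inr (κ i)) := by simp [kHat]

lemma T_det {V Λ : Type*} {r n : ℕ} (e : Λ ⊕ Λ ≃ V) (step : V → Fin (r+1)) (fl : Λ → Prop)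
    (hst : ∀ i, step (e (Sum.inl i)) ≤ step (e (Sum.inr i)))
    (x x' : (V → Fin n) × Equiv.Perm V)
    (hx : QQ (fun i => e (Sum.inl i)) (fun i => e (Sum.inr i)) step fl x)
    (hx' : QQ (fun i => e (Sum.inl i)) (fun i => e (Sum.inr i)) step fl x')
    (hlast : ∀ s, step s = Fin.last r → x.1 s = x'.1 s)
    (hnew : ∀ i, x.1 (e (Sum.inl i)) = x'.1 (e (Sum.inl i)))
    (hpi : ∀ i, x.2 (e (Sum.inl i)) = x'.2 (e (Sum.inl i))) : x.1 = x'.1 := by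
  have key : ∀ j : ℕ, ∀ s, (step s : ℕ) = j → x.1 s = x'.1 s := by
    intro j
    induction j using Nat.strong_induction_on with
    | _ j ih =>
      intro s hs
      obtain ⟨u, rfl⟩ := e.surjective s
      rcases u with i | i
      · exact hnew i
      · by_cases hf : fl i
        · have h1 := ((hx.2 i).1 hf).1
          have h2 := ((hx'.2 i).1 hf).1
          rw [← h1, ← h2]
          have h3 : step (x.2 (e (Sum.inl i))) = step (e (Sum.inl i)) - 1 := hx.1 _
          have h4 : x.1 (x.2 (e (Sum.inl i))) = x'.1 (x.2 (e (Sum.inl i))) := by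
            by_cases h0 : step (e (Sum.inl i)) = 0
            · apply hlast
              rw [h3, h0]
              ext
              rw [Fin.coe_sub_one]
              simp
            · apply ih _ _ _ rfl
              have h5 := hst i
              rw [h3]
              have h6 : ((step (e (Sum.inl i)) - 1 : Fin (r+1)) : ℕ)
                  = (step (e (Sum.inl i)) : ℕ) - 1 := by
                rw [Fin.coe_sub_one]; simp [h0]
              have h7 : (step (e (Sum.inl i)) : ℕ) ≠ 0 := by
                intro h; apply h0; ext; simpa using h
              have h8 : (step (e (Sum.inl i)) : ℕ) ≤ step (e (Sum.inr i)) := h5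
              omega
          rw [← hpi i]
          exact h4
        · have h1 := ((hx.2 i).2 hf).2
          have h2 := ((hx'.2 i).2 hf).2
          rw [← h1, ← h2]
          exact hnew i
  funext s
  exact key _ s rfl

open Classical in
lemma conserve {V Λ : Type*} [Fintype V] [Fintype Λ] {r n : ℕ} (e : Λ ⊕ Λ ≃ V)
    (step : V → Fin (r+1)) (fl : Λ → Prop)
    (x : (V → Fin n) × Equiv.Perm V)
    (hx : QQ (fun i => e (Sum.inl i)) (fun i => e (Sum.inr i)) step fl x) (v : Fin n) :
    Fintype.card {i // x.1 (x.2 (e (Sum.inr i))) = v} =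
      Fintype.card {i // x.1 (e (Sum.inl i)) = v} := by
  simp only [Fintype.card_subtype, Finset.card_filter]
  have h1 : ∑ s, (if x.1 (x.2 s) = v then 1 else 0) = ∑ s, (if x.1 s = v then 1 else 0) :=
    Equiv.sum_comp x.2 (fun s => if x.1 s = v then 1 else 0)
  rw [← Equiv.sum_comp e, ← Equiv.sum_comp e, Fintype.sum_sum_type, Fintype.sum_sum_type] at h1
  have h2 : ∑ i, ((if x.1 (x.2 (e (Sum.inr i))) = v then 1 else 0)
        + (if x.1 (e (Sum.inr i)) = v then 1 else 0))
      = ∑ i, ((if x.1 (x.2 (e (Sum.inl i))) = v then 1 else 0)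
        + (if x.1 (e (Sum.inl i)) = v then 1 else 0)) := by
    apply Finset.sum_congr rfl
    intro i _
    by_cases hf : fl i
    · have := (hx.2 i).1 hf
      simp only at this
      rw [this.1, this.2, add_comm]
    · have := (hx.2 i).2 hf
      simp only at this
      rw [this.1, this.2]
  rw [Finset.sum_add_distrib, Finset.sum_add_distrib] at h2
  omega

open Classical in
lemma core_count {V Λ : Type*} [Fintype V] [Fintype Λ] {r n : ℕ} (e : Λ ⊕ Λ ≃ V)
    (step : V → Fin (r+1)) (fl : Λ → Prop)
    (hst : ∀ i, step (e (Sum.inl i)) ≤ step (e (Sum.inr i))) :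
    Fintype.card {x : (V → Fin n) × Equiv.Perm V //
      QQ (fun i => e (Sum.inl i)) (fun i => e (Sum.inr i)) step fl x} * (Fintype.card Λ).factorial
    ≤ n ^ (Fintype.card {s // step s = Fin.last r}) * (Fintype.card V).factorial *
      ∑ y : Λ → Fin n, ∏ v, (Fintype.card {i // y i = v}).factorial := by
  set Q := {x : (V → Fin n) × Equiv.Perm V //
      QQ (fun i => e (Sum.inl i)) (fun i => e (Sum.inr i)) step fl x}
  let Φ : Q × Equiv.Perm Λ → (({s // step s = Fin.last r} → Fin n) × Equiv.Perm V) × (Λ → Fin n) :=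
    fun z => ((fun s => z.1.1.1 s.1, (kHat e z.2).trans z.1.1.2), fun i => z.1.1.1 (e (Sum.inl i)))
  have hcard : Fintype.card (Q × Equiv.Perm Λ) = Fintype.card Q * (Fintype.card Λ).factorial := by
    rw [Fintype.card_prod, Fintype.card_perm]
  rw [← hcard]
  have hrhs : n ^ (Fintype.card {s // step s = Fin.last r}) * (Fintype.card V).factorial *
      ∑ y : Λ → Fin n, ∏ v, (Fintype.card {i // y i = v}).factorial
      = ∑ w : (({s // step s = Fin.last r} → Fin n) × Equiv.Perm V) × (Λ → Fin n),
        ∏ v, (Fintype.card {i // w.2 i = v}).factorial := by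
    rw [Fintype.sum_prod_type]
    have hh : ∀ x : ({s // step s = Fin.last r} → Fin n) × Equiv.Perm V,
        (∑ y : Λ → Fin n, ∏ v, (Fintype.card {i // (x, y).2 i = v}).factorial)
        = ∑ y : Λ → Fin n, ∏ v, (Fintype.card {i // y i = v}).factorial := fun _ => rfl
    rw [Finset.sum_congr rfl (fun x _ => hh x), Finset.sum_const, Finset.card_univ,
      Fintype.card_prod, Fintype.card_perm, Fintype.card_fun, Fintype.card_fin, smul_eq_mul]
  rw [hrhs, ← Finset.card_univ,
    Finset.card_eq_sum_card_fiberwise (f := Φ) (t := Finset.univ) (by intro a _; simp)]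
  apply Finset.sum_le_sum
  intro w _
  by_cases hne : ∃ z0, Φ z0 = w
  swap
  · rw [Finset.card_eq_zero.2]
    · exact Nat.zero_le _
    · ext z; simp only [Finset.mem_filter, Finset.mem_univ, true_and]
      constructor
      · intro h; exact absurd ⟨z, h⟩ hne
      · intro h; simp at h
  obtain ⟨z0, hz0⟩ := hne
  obtain ⟨⟨x0, hx0⟩, κ0⟩ := z0
  set So : Λ → Fin n := fun i => x0.1 (x0.2 (e (Sum.inr i))) with hSo
  have hw : ∏ v, (Fintype.card {i // w.2 i = v}).factorial
      = Fintype.card {g : Equiv.Perm Λ // So ∘ g = So} := by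
    rw [DomMulAct.stabilizer_card]
    apply Finset.prod_congr rfl
    intro v _
    have := conserve e step fl x0 hx0 v
    rw [show Fintype.card {i // So i = v} = Fintype.card {i // x0.1 (x0.2 (e (Sum.inr i))) = v}
      from rfl, this, ← hz0]
  rw [hw, ← Fintype.card_subtype]
  -- facts about members of the fibre
  have fact : ∀ (x : (V → Fin n) × Equiv.Perm V) (hx) (κ : Equiv.Perm Λ), Φ (⟨x, hx⟩, κ) = w →
      x.1 = x0.1 ∧ x.2 = ((kHat e κ).symm).trans ((kHat e κ0).trans x0.2) ∧
        (∀ i, x.1 (x.2 (e (Sum.inr i))) = So i) := by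
    intro x hx κ h
    rw [← hz0] at h
    have h1 := congrArg (fun u => u.1.1) h
    have h2 := congrArg (fun u => u.1.2) h
    have h3 := congrArg (fun u => u.2) h
    simp only [Φ] at h1 h2 h3
    have hpi : ∀ i, x.2 (e (Sum.inl i)) = x0.2 (e (Sum.inl i)) := by
      intro i
      have := congrArg (fun g => g (e (Sum.inl i))) h2
      simpa [kHat_inl] using this
    have hT : x.1 = x0.1 := by
      apply T_det e step fl hst x x0 hx hx0 _ (fun i => congrFun h3 i) hpi
      intro s hs
      exact congrFun h1 ⟨s, hs⟩
    refine ⟨hT, ?_, ?_⟩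
    · rw [← h2]
      ext s; simp
    · intro i
      by_cases hf : fl i
      · have a1 := ((hx.2 i).1 hf).2
        have a2 := ((hx0.2 i).1 hf).2
        simp only at a1 a2
        rw [← a1, hSo]; simp only
        rw [← a2, hT]
      · have a1 := ((hx.2 i).2 hf).1
        have a2 := ((hx0.2 i).2 hf).1
        simp only at a1 a2
        rw [← a1, hSo]; simp only
        rw [← a2, hT, hpi]
  have fact2 : ∀ (x : (V → Fin n) × Equiv.Perm V) (hx) (κ : Equiv.Perm Λ), Φ (⟨x, hx⟩, κ) = w →
      So ∘ (κ0.symm.trans κ) = So := by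
    intro x hx κ h
    obtain ⟨h1, h2, h3⟩ := fact x hx κ h
    funext i
    simp only [Function.comp, Equiv.trans_apply]
    rw [← h3, h1, h2]
    simp only [Equiv.trans_apply]
    rw [show (kHat e κ).symm (e (Sum.inr (κ (κ0.symm i)))) = e (Sum.inr (κ0.symm i)) by
      rw [Equiv.symm_apply_eq, kHat_inr]]
    rw [kHat_inr]
    simp [hSo]
  let Ψ : {z // Φ z = w} → {g : Equiv.Perm Λ // So ∘ g = So} :=
    fun z => ⟨κ0.symm.trans z.1.2, fact2 z.1.1.1 z.1.1.2 z.1.2 z.2⟩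
  apply Fintype.card_le_of_injective Ψ
  rintro ⟨⟨⟨x, hx⟩, κ⟩, h⟩ ⟨⟨⟨x', hx'⟩, κ'⟩, h'⟩ hh
  have hk : κ0.symm.trans κ = κ0.symm.trans κ' := congrArg Subtype.val hh
  have hk' : κ = κ' := by
    ext i
    have := congrArg (fun g => g (κ0 i)) hk
    simpa using this
  subst hk'
  obtain ⟨a1, a2, -⟩ := fact x hx κ h
  obtain ⟨b1, b2, -⟩ := fact x' hx' κ h'
  have : x = x' := Prod.ext (a1.trans b1.symm) (a2.trans b2.symm)
  subst this
  rfl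

open Classical in
lemma sum_fact (n L : ℕ) : ∑ y : Fin L → Fin n, ∏ v, (Fintype.card {i // y i = v}).factorial
    ≤ (n + L) ^ L := by
  have h : ∑ y : Fin L → Fin n, ∏ v, (Fintype.card {i // y i = v}).factorial
      = n.ascFactorial L := by
    induction L with
    | zero => simp
    | succ L ih =>
      rw [← Equiv.sum_comp (Fin.consEquiv (fun _ : Fin (L+1) => Fin n)), Fintype.sum_prod_type,
        Finset.sum_comm, Nat.ascFactorial_succ, ← ih, Finset.mul_sum]
      apply Finset.sum_congr rfl
      intro y _
      have hc : ∀ (u v : Fin n), Fintype.card {i // (Fin.consEquiv (fun _ : Fin (L+1) => Fin n)) (u, y) i = v}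
          = (if u = v then 1 else 0) + Fintype.card {i // y i = v} := by
        intro u v
        simp only [Fintype.card_subtype, Finset.card_filter]
        rw [Fin.sum_univ_succ]
        simp [Fin.consEquiv]
      have hp : ∀ u, ∏ v, (Fintype.card {i // (Fin.consEquiv (fun _ : Fin (L+1) => Fin n)) (u, y) i = v}).factorial
          = (Fintype.card {i // y i = u} + 1) * ∏ v, (Fintype.card {i // y i = v}).factorial := by
        intro u
        simp only [hc]
        rw [← Finset.mul_prod_erase _ _ (Finset.mem_univ u),
          ← Finset.mul_prod_erase (Finset.univ) (fun v => (Fintype.card {i // y i = v}).factorial) (Finset.mem_univ u)]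
        simp only [if_true]
        rw [add_comm 1, Nat.factorial_succ, mul_assoc]
        congr 2
        apply Finset.prod_congr rfl
        intro v hv
        have : u ≠ v := fun h => by simp [h] at hv
        simp [this]
      simp only [hp]
      rw [← Finset.sum_mul, Finset.sum_add_distrib]
      congr 1
      have : ∑ u, Fintype.card {i // y i = u} = L := by
        have := Fintype.card_congr (Equiv.sigmaFiberEquiv y)
        rw [Fintype.card_sigma] at this
        simpa using this
      rw [this]; simp [add_comm]
  rw [h]
  clear h
  induction L with
  | zero => simp
  | succ L ih =>
    rw [Nat.ascFactorial_succ, pow_succ, mul_comm]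
    apply Nat.mul_le_mul (ih.trans (Nat.pow_le_pow_left (by omega) _)) (by omega)

open Classical in
lemma even_match {B Ω : Type*} (K : B → Ω) (step : B → ℕ) (N : ℕ) :
    ∀ s : Finset B, s.card ≤ N → (∀ ω, Even (s.filter (fun b => K b = ω)).card) →
    ∃ X : Finset B, X ⊆ s ∧ ∃ φ : B → B, Set.InjOn φ (X : Set B) ∧ X.image φ = s \ X ∧
      ∀ b ∈ X, K b = K (φ b) ∧ step b ≤ step (φ b) := by
  induction N with
  | zero =>
    intro s hs _
    have : s = ∅ := by simpa using hs
    subst this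
    exact ⟨∅, by simp, id, by simp, by simp, by simp⟩
  | succ N ih =>
    intro s hs hev
    by_cases hne : s = ∅
    · subst hne
      exact ⟨∅, by simp, id, by simp, by simp, by simp⟩
    obtain ⟨b0, hb0⟩ := Finset.nonempty_iff_ne_empty.2 hne
    have hlt : 1 < (s.filter (fun b => K b = K b0)).card := by
      have h1 : 0 < (s.filter (fun b => K b = K b0)).card :=
        Finset.card_pos.2 ⟨b0, by simp [hb0]⟩
      have h2 := hev (K b0)
      obtain ⟨c, hc⟩ := h2
      omega
    obtain ⟨b1, hb1, hne1⟩ := Finset.exists_mem_ne hlt b0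
    simp only [Finset.mem_filter] at hb1
    obtain ⟨a, a', ha, ha', haa, hK, hstep⟩ : ∃ a a', a ∈ s ∧ a' ∈ s ∧ a ≠ a' ∧ K a = K a' ∧
        step a ≤ step a' := by
      rcases le_total (step b0) (step b1) with h | h
      · exact ⟨b0, b1, hb0, hb1.1, hne1.symm, hb1.2.symm, h⟩
      · exact ⟨b1, b0, hb1.1, hb0, hne1, hb1.2, h⟩
    set s' := (s.erase a).erase a' with hs'
    have ha's : a' ∈ s.erase a := by simp [ha', haa.symm]
    have hcard : s'.card + 2 = s.card := by
      have h1 := Finset.card_erase_add_one ha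
      have h2 := Finset.card_erase_add_one ha's
      rw [hs']
      omega
    have hev' : ∀ ω, Even (s'.filter (fun b => K b = ω)).card := by
      intro ω
      rw [hs', Finset.filter_erase, Finset.filter_erase]
      by_cases hω : K a = ω
      · have m1 : a ∈ s.filter (fun b => K b = ω) := by simp [ha, hω]
        have m2 : a' ∈ (s.filter (fun b => K b = ω)).erase a := by
          simp [ha', ← hK, hω, haa.symm]
        have h1 := Finset.card_erase_add_one m1
        have h2 := Finset.card_erase_add_one m2
        obtain ⟨c, hc⟩ := hev ω
        exact ⟨c - 1, by omega⟩
      · rw [Finset.erase_eq_of_notMem, Finset.erase_eq_of_notMem]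
        · exact hev ω
        · simp [hω]
        · simp [← hK, hω]
    obtain ⟨X, hXs, φ, hinj, him, hφ⟩ := ih s' (by omega) hev'
    have haX : a ∉ X := fun h => by have := hXs h; simp [hs'] at this
    have ha'X : a' ∉ X := fun h => by have := hXs h; simp [hs'] at this
    have hφX : ∀ b ∈ X, φ b ∈ s' \ X := fun b hb => him ▸ Finset.mem_image_of_mem φ hb
    have hup : ∀ b ∈ X, Function.update φ a a' b = φ b := fun b hb =>
      Function.update_of_ne (fun h => haX (by rw [← h]; exact hb)) _ _
    refine ⟨insert a X, ?_, Function.update φ a a', ?_, ?_, ?_⟩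
    · intro b hb
      rcases Finset.mem_insert.1 hb with rfl | hb
      · exact ha
      · have := hXs hb
        simp only [hs', Finset.mem_erase] at this
        exact this.2.2
    · intro x hx y hy hxy
      simp only [Finset.coe_insert, Set.mem_insert_iff, Finset.mem_coe] at hx hy
      rcases hx with rfl | hx <;> rcases hy with rfl | hy
      · rfl
      · rw [Function.update_self, hup y hy] at hxy
        have := hφX y hy
        rw [← hxy] at this
        simp [hs'] at this
      · rw [Function.update_self, hup x hx] at hxy
        have := hφX x hx
        rw [hxy] at this
        simp [hs'] at this
      · rw [hup x hx, hup y hy] at hxy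
        exact hinj hx hy hxy
    · rw [Finset.image_insert, Function.update_self,
        Finset.image_congr (g := φ) (fun b hb => hup b hb), him]
      ext b
      simp only [hs', Finset.mem_insert, Finset.mem_sdiff, Finset.mem_erase]
      constructor
      · rintro (rfl | h)
        · exact ⟨ha', by simp [haa.symm, ha'X]⟩
        · exact ⟨h.1.2.2, by simp [h.1.2.1, h.2]⟩
      · rintro ⟨h1, h2⟩
        by_cases hb : b = a'
        · exact Or.inl hb
        · simp only [not_or] at h2
          exact Or.inr ⟨⟨hb, h2.1, h1⟩, h2.2⟩
    · intro b hb
      rcases Finset.mem_insert.1 hb with rfl | hb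
      · rw [Function.update_self]; exact ⟨hK, hstep⟩
      · rw [hup b hb]; exact hφ b hb

/-- Encodings of pairings of blocks. -/
abbrev Enc (B : Type*) (m : ℕ) := {X : Finset B // X.card = m} × (Fin m → B)

/-- The new block with index `i`. -/
noncomputable def Enc.al {B : Type*} {m : ℕ} (E : Enc B m) (i : Fin m) : B :=
  ((E.1.1.equivFinOfCardEq E.1.2).symm i : B)

/-- validity of an encoding -/
def Enc.Valid {B : Type*} {m : ℕ} (E : Enc B m) (step : B → ℕ) : Prop :=
  Function.Bijective (Sum.elim E.al E.2) ∧ ∀ i, step (E.al i) ≤ step (E.2 i)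

open Classical in
lemma exists_enc {B Ω : Type*} [Fintype B] (K : B → Ω) (step : B → ℕ) (m : ℕ)
    (hB : Fintype.card B = 2 * m)
    (hev : ∀ ω, Even ((Finset.univ : Finset B).filter (fun b => K b = ω)).card) :
    ∃ E : Enc B m, E.Valid step ∧ ∀ i, K (E.al i) = K (E.2 i) := by
  obtain ⟨X, hX, φ, hinj, him, hφ⟩ := even_match K step _ Finset.univ le_rfl hev
  have hc : X.card = m := by
    have h1 := Finset.card_image_of_injOn hinj
    rw [him] at h1
    have h2 := Finset.card_sdiff_add_card_eq_card hX
    rw [Finset.card_univ, hB] at h2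
    omega
  let α : Fin m → B := fun i => ((X.equivFinOfCardEq hc).symm i : B)
  have hα : ∀ i, α i ∈ X := fun i => ((X.equivFinOfCardEq hc).symm i).2
  refine ⟨(⟨X, hc⟩, fun i => φ (α i)), ⟨?_, ?_⟩, ?_⟩
  · rw [Fintype.bijective_iff_injective_and_card]
    refine ⟨?_, by simp [hB]; omega⟩
    have hαi : Function.Injective α := fun i j h =>
      (X.equivFinOfCardEq hc).symm.injective (Subtype.ext h)
    apply Function.Injective.sumElim
    · exact hαi
    · intro i j h
      exact hαi (hinj (hα i) (hα j) h)
    · intro i j h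
      have h1 : φ (α j) ∈ Finset.univ \ X := him ▸ Finset.mem_image_of_mem φ (hα j)
      have h2 : α i = φ (α j) := h
      rw [← h2] at h1
      simp [hα i] at h1
  · intro i; exact (hφ _ (hα i)).2
  · intro i; exact (hφ _ (hα i)).1

lemma card_enc (B : Type*) [Fintype B] [DecidableEq B] (m : ℕ) (hB : Fintype.card B = 2 * m) :
    Fintype.card (Enc B m) ≤ 4 ^ m * (2 * m) ^ m := by
  rw [Fintype.card_prod, Fintype.card_fun, Fintype.card_fin, hB]
  apply Nat.mul_le_mul_right
  refine (Fintype.card_subtype_le _).trans ?_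
  rw [Fintype.card_finset, hB, pow_mul]; norm_num

/-- sign of a Boolean -/
def sgB (b : Bool) : ℝ := if b then 1 else -1

lemma abs_sgB (b : Bool) : |sgB b| = 1 := by cases b <;> simp [sgB]

open Classical in
lemma exp_signs {B Ω : Type*} [Fintype B] [Fintype Ω] (K : B → Ω) :
    ∑ A : Ω → Bool, ∏ b, sgB (A (K b)) ≤
      if (∀ ω, Even ((Finset.univ : Finset B).filter (fun b => K b = ω)).card)
      then (Fintype.card (Ω → Bool) : ℝ) else 0 := by
  split_ifs with h
  · calc ∑ A : Ω → Bool, ∏ b, sgB (A (K b)) ≤ ∑ A : Ω → Bool, (1:ℝ) := by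
          apply Finset.sum_le_sum
          intro A _
          refine (le_abs_self _).trans ?_
          rw [Finset.abs_prod]
          simp [abs_sgB]
      _ = _ := by simp
  · push Not at h
    obtain ⟨ω, hω⟩ := h
    rw [Nat.not_even_iff_odd] at hω
    apply le_of_eq
    have hflip : ∀ A : Ω → Bool, ∏ b, sgB (Function.update A ω (!(A ω)) (K b))
        = - ∏ b, sgB (A (K b)) := by
      intro A
      have : ∀ b, sgB (Function.update A ω (!(A ω)) (K b))
          = (if K b = ω then -1 else 1) * sgB (A (K b)) := by
        intro b
        by_cases hb : K b = ω
        · subst hb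
          rw [Function.update_self]
          cases A (K b) <;> simp [sgB]
        · rw [Function.update_of_ne hb]; simp [hb]
      simp only [this, Finset.prod_mul_distrib]
      rw [Finset.prod_ite]
      simp [hω.neg_one_pow]
    have he : Function.Involutive (fun A : Ω → Bool => Function.update A ω (!(A ω))) := by
      intro A
      funext x
      by_cases hx : x = ω
      · subst hx; simp
      · simp [Function.update_of_ne hx]
    have := Equiv.sum_comp he.toPerm (fun A : Ω → Bool => ∏ b, sgB (A (K b)))
    simp only [Function.Involutive.coe_toPerm, hflip, Finset.sum_neg_distrib] at this
    linarith

/-- product of the first `r` matrices of a sequence -/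
def wp {ι : Type*} [Fintype ι] [DecidableEq ι] (C : ℕ → Matrix ι ι ℝ) : ℕ → Matrix ι ι ℝ
  | 0 => 1
  | r + 1 => wp C r * C r

lemma wp_apply {ι : Type*} [Fintype ι] [DecidableEq ι] (C : ℕ → Matrix ι ι ℝ) (r : ℕ) (i j : ι) :
    wp C r i j = ∑ T : Fin r → ι,
      if (Fin.cons i T : Fin (r+1) → ι) (Fin.last r) = j then
        ∏ l : Fin r, C l ((Fin.cons i T : Fin (r+1) → ι) l.castSucc) (T l) else 0 := by
  induction r generalizing j with
  | zero => simp [wp, Matrix.one_apply, Fin.last]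
  | succ r ih =>
    rw [wp, Matrix.mul_apply, ← Equiv.sum_comp (Fin.snocEquiv (fun _ : Fin (r+1) => ι)),
      Fintype.sum_prod_type]
    have h1 : ∀ (x : ι) (T : Fin r → ι),
        (Fin.cons i (Fin.snoc T x : Fin (r+1) → ι) : Fin (r+2) → ι)
          = Fin.snoc (Fin.cons i T : Fin (r+1) → ι) x := by
      intro x T
      exact Fin.cons_snoc_eq_snoc_cons i T x
    simp only [Fin.snocEquiv, Equiv.coe_fn_mk, h1, Fin.snoc_last, Fin.prod_univ_castSucc,
      Fin.snoc_castSucc, Fin.val_castSucc, Fin.val_last]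
    symm
    rw [Finset.sum_eq_single j]
    · simp only [if_true, ih, Finset.sum_mul]
      rw [Finset.sum_comm]
      apply Finset.sum_congr rfl
      intro T _
      symm
      rw [Finset.sum_eq_single ((Fin.cons i T : Fin (r+1) → ι) (Fin.last r))]
      · simp
      · intro x _ hx; simp [hx.symm]
      · simp
    · intro x _ hx; simp [hx]
    · simp

lemma trace_wp {ι : Type*} [Fintype ι] [DecidableEq ι] (C : ℕ → Matrix ι ι ℝ) (r : ℕ) :
    (wp C (r+1)).trace = ∑ T : Fin (r+1) → ι, ∏ l : Fin (r+1), C l (T (l - 1)) (T l) := by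
  simp only [Matrix.trace, Matrix.diag, wp_apply]
  rw [Finset.sum_comm]
  apply Finset.sum_congr rfl
  intro T _
  have h : ∀ i, (Fin.cons i T : Fin (r+2) → ι) (Fin.last (r+1)) = T (Fin.last r) := by
    intro i; rw [← Fin.succ_last, Fin.cons_succ]
  simp only [h]
  rw [Finset.sum_eq_single (T (Fin.last r))]
  · simp only [if_true]
    apply Finset.prod_congr rfl
    intro l _
    congr 1
    refine Fin.cases ?_ (fun l' => ?_) l
    · simp only [Fin.castSucc_zero, Fin.cons_zero]
      congr 1
      ext; rw [Fin.coe_sub_one]; simp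
    · rw [← Fin.succ_castSucc, Fin.cons_succ]
      congr 1
      ext; rw [Fin.coe_sub_one]; simp
  · intro x _ hx; simp [hx.symm]
  · simp

open Matrix in
lemma cs_dot {ι : Type*} [Fintype ι] (x y : ι → ℝ) :
    (x ⬝ᵥ y) ^ 2 ≤ (x ⬝ᵥ x) * (y ⬝ᵥ y) := by
  have := Finset.sum_mul_sq_le_sq_mul_sq Finset.univ x y
  simpa [dotProduct, sq] using this

open Matrix in
lemma mulVec_sq_le {ι : Type*} [Fintype ι] [DecidableEq ι] (Z : Matrix ι ι ℝ) (y : ι → ℝ)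
    (hy : y ⬝ᵥ y = 1) : (Z *ᵥ y) ⬝ᵥ (Z *ᵥ y) ≤ (Z * Zᵀ).trace := by
  rw [Matrix.trace, dotProduct]
  apply Finset.sum_le_sum
  intro i _
  have := cs_dot (Z i) y
  rw [hy, mul_one] at this
  simp only [diag, mul_apply, transpose_apply]
  calc (Z *ᵥ y) i * (Z *ᵥ y) i = (Z i ⬝ᵥ y)^2 := by rw [sq]; rfl
    _ ≤ _ := this

open Matrix in
lemma quad_pow {ι : Type*} [Fintype ι] [DecidableEq ι] (X : Matrix ι ι ℝ) (hX : Xᵀ = X)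
    (y : ι → ℝ) (hy : y ⬝ᵥ y = 1) (hpos : 0 ≤ y ⬝ᵥ (X *ᵥ y)) (j : ℕ) :
    (y ⬝ᵥ (X *ᵥ y)) ^ (2^j) ≤ y ⬝ᵥ ((X ^ (2^j)) *ᵥ y) := by
  induction j with
  | zero => simp
  | succ j ih =>
    rw [pow_succ 2 j, pow_mul]
    have hT : (X ^ (2^j))ᵀ = X ^ (2^j) := by rw [transpose_pow, hX]
    have h2 : y ⬝ᵥ ((X ^ (2^j * 2)) *ᵥ y) = ((X ^ (2^j)) *ᵥ y) ⬝ᵥ ((X ^ (2^j)) *ᵥ y) := by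
      rw [pow_mul, sq, ← mulVec_mulVec, dotProduct_mulVec, ← mulVec_transpose, hT]
    rw [h2]
    have h3 := cs_dot y ((X ^ (2^j)) *ᵥ y)
    rw [hy, one_mul] at h3
    refine le_trans ?_ h3
    apply pow_le_pow_left₀ (by positivity) ih

open Matrix in
lemma quad_trace {ι : Type*} [Fintype ι] [DecidableEq ι] (M : Matrix ι ι ℝ)
    (y : ι → ℝ) (hy : y ⬝ᵥ y = 1) (j : ℕ) :
    (y ⬝ᵥ (M *ᵥ y)) ^ (2 * 2^j) ≤ ((M * Mᵀ) ^ (2^j)).trace := by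
  have hX : (M * Mᵀ)ᵀ = M * Mᵀ := by simp
  have h1 : y ⬝ᵥ ((M * Mᵀ) *ᵥ y) = (Mᵀ *ᵥ y) ⬝ᵥ (Mᵀ *ᵥ y) := by
    rw [← mulVec_mulVec, dotProduct_mulVec, ← mulVec_transpose]
  have h0 : 0 ≤ y ⬝ᵥ ((M * Mᵀ) *ᵥ y) := by
    rw [h1]; exact Finset.sum_nonneg (fun i _ => mul_self_nonneg _)
  have h2 : (y ⬝ᵥ (M *ᵥ y)) ^ 2 ≤ y ⬝ᵥ ((M * Mᵀ) *ᵥ y) := by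
    rw [h1, dotProduct_mulVec, ← mulVec_transpose]
    have := cs_dot (Mᵀ *ᵥ y) y
    rwa [hy, mul_one] at this
  rw [pow_mul]
  refine (pow_le_pow_left₀ (sq_nonneg _) h2 _).trans ?_
  refine (quad_pow _ hX y hy h0 j).trans ?_
  cases j with
  | zero =>
    simp only [pow_zero, pow_one]
    rw [h1]
    refine (mulVec_sq_le _ y hy).trans ?_
    rw [transpose_transpose, trace_mul_comm]
  | succ j =>
    have hT : ((M * Mᵀ) ^ (2^j))ᵀ = (M * Mᵀ) ^ (2^j) := by rw [transpose_pow, hX]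
    have := mulVec_sq_le ((M * Mᵀ) ^ (2^j)) y hy
    rw [hT] at this
    rw [pow_succ 2 j, pow_mul, sq]
    rw [← mulVec_mulVec, dotProduct_mulVec, ← mulVec_transpose, hT]
    exact this

open Classical in
lemma sum_fact' (n : ℕ) (Λ : Type*) [Fintype Λ] :
    ∑ y : Λ → Fin n, ∏ v, (Fintype.card {i // y i = v}).factorial
    ≤ (n + Fintype.card Λ) ^ (Fintype.card Λ) := by
  refine le_trans (le_of_eq ?_) (sum_fact n (Fintype.card Λ))
  rw [← Equiv.sum_comp (Equiv.arrowCongr (Fintype.equivFin Λ) (Equiv.refl (Fin n)))]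
  apply Finset.sum_congr rfl
  intro y _
  apply Finset.prod_congr rfl
  intro v _
  congr 1
  apply Fintype.card_congr
  exact (Fintype.equivFin Λ).subtypeEquiv (fun a => by simp [Equiv.arrowCongr])

/-- words -/
abbrev Wd (n k h : ℕ) := Fin k × Fin h → Fin n

/-- Kronecker power of the matrix of a tensor -/
def kron {n k h : ℕ} (a : (Fin (h+h) → Fin n) → ℝ) : Matrix (Wd n k h) (Wd n k h) ℝ :=
  fun I J => ∏ m, a (Fin.append (fun r => I (m, r)) (fun r => J (m, r)))

open Classical in
/-- projection to symmetric words -/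
noncomputable def PP (n k h : ℕ) : Matrix (Wd n k h) (Wd n k h) ℝ :=
  fun I J => ((k * h).factorial : ℝ)⁻¹ *
    ∑ π : Equiv.Perm (Fin k × Fin h), if I ∘ π = J then 1 else 0

lemma PP_mul {n k h : ℕ} (Z : Matrix (Wd n k h) (Wd n k h) ℝ) (I J : Wd n k h) :
    (PP n k h * Z) I J = ((k * h).factorial : ℝ)⁻¹ *
      ∑ π : Equiv.Perm (Fin k × Fin h), Z (I ∘ π) J := by
  classical
  rw [Matrix.mul_apply]
  simp only [PP, mul_assoc, ← Finset.mul_sum, Finset.sum_mul]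
  rw [Finset.sum_comm]
  congr 1
  apply Finset.sum_congr rfl
  intro π _
  simp

lemma PP_comp {n k h : ℕ} (I J : Wd n k h) (π : Equiv.Perm (Fin k × Fin h)) :
    PP n k h (I ∘ π) J = PP n k h I J := by
  classical
  simp only [PP]
  congr 1
  rw [← Equiv.sum_comp (Equiv.mulLeft π) (fun σ : Equiv.Perm (Fin k × Fin h) => if I ∘ σ = J then (1:ℝ) else 0)]
  rfl

lemma PP_idem (n k h : ℕ) : PP n k h * PP n k h = PP n k h := by
  ext I J
  rw [PP_mul]
  simp only [PP_comp, Finset.sum_const, Finset.card_univ, Fintype.card_perm, Fintype.card_prod,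
    Fintype.card_fin, nsmul_eq_mul]
  rw [← mul_assoc, inv_mul_cancel₀ (by positivity), one_mul]

lemma PP_symm (n k h : ℕ) : (PP n k h).transpose = PP n k h := by
  classical
  ext I J
  simp only [Matrix.transpose_apply, PP]
  congr 1
  rw [← Equiv.sum_comp (Equiv.inv (Equiv.Perm (Fin k × Fin h)))]
  apply Finset.sum_congr rfl
  intro π _
  congr 1
  apply propext
  simp only [Equiv.inv_apply]
  constructor
  · intro h; rw [← h]; funext x; simp
  · intro h; rw [← h]; funext x; simp

/-- the step matrices -/
noncomputable def CC {n k h : ℕ} (a : (Fin (h+h) → Fin n) → ℝ) (l : ℕ) :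
    Matrix (Wd n k h) (Wd n k h) ℝ :=
  if l % 2 = 0 then PP n k h * kron a else PP n k h * (kron a).transpose

lemma wp_CC {n k h : ℕ} (a : (Fin (h+h) → Fin n) → ℝ) (p : ℕ) :
    wp (CC (k := k) a) (2 * p)
      = (PP n k h * kron a * (PP n k h * (kron a).transpose)) ^ p := by
  induction p with
  | zero => simp [wp]
  | succ p ih =>
    rw [show 2 * (p+1) = 2 * p + 1 + 1 by ring, wp, wp, ih, pow_succ, mul_assoc]
    congr 2
    · simp [CC]
    · have : (2 * p + 1) % 2 ≠ 0 := by omega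
      simp [CC]

lemma trace_MM {n k h : ℕ} (a : (Fin (h+h) → Fin n) → ℝ) (p : ℕ) (hp : p ≠ 0) :
    (((PP n k h * kron a * PP n k h) * (PP n k h * kron a * PP n k h).transpose) ^ p).trace
      = (wp (CC (k := k) a) (2 * p)).trace := by
  rw [wp_CC]
  set P := PP n k h
  have hP : P * P = P := PP_idem n k h
  have hPt : P.transpose = P := PP_symm n k h
  set K : Matrix (Wd n k h) (Wd n k h) ℝ := kron a
  set G := P * K * (P * K.transpose) with hG
  have h1 : (P * K * P) * (P * K * P).transpose = G * P := by
    rw [Matrix.transpose_mul, Matrix.transpose_mul, hPt, hG]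
    simp only [Matrix.mul_assoc]
    rw [← Matrix.mul_assoc P P, hP]
  have h2 : P * G = G := by
    rw [hG]; simp only [← Matrix.mul_assoc]; rw [hP]
  have h3 : ∀ p : ℕ, (G * P) ^ (p+1) = G ^ (p+1) * P := by
    intro p
    induction p with
    | zero => simp
    | succ p ih =>
      rw [pow_succ, ih, pow_succ G (p+1)]
      simp only [Matrix.mul_assoc]
      rw [← Matrix.mul_assoc P G, h2]
  rw [h1]
  obtain ⟨p', rfl⟩ := Nat.exists_eq_succ_of_ne_zero hp
  rw [Nat.succ_eq_add_one, h3, Matrix.trace_mul_comm, pow_succ', ← Matrix.mul_assoc, h2]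

/-- the block labels -/
def Kb {n k h r : ℕ} (T : Fin (r+1) → Wd n k h) (π : Fin (r+1) → Equiv.Perm (Fin k × Fin h))
    (b : Fin (r+1) × Fin k) : Fin (h+h) → Fin n :=
  if (b.1 : ℕ) % 2 = 0 then
    Fin.append (fun ρ => T (b.1 - 1) (π b.1 (b.2, ρ))) (fun ρ => T b.1 (b.2, ρ))
  else Fin.append (fun ρ => T b.1 (b.2, ρ)) (fun ρ => T (b.1 - 1) (π b.1 (b.2, ρ)))

lemma trace_expand {n k h : ℕ} (a : (Fin (h+h) → Fin n) → ℝ) (r : ℕ) :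
    (wp (CC (k := k) a) (r+1)).trace = (((k * h).factorial : ℝ)⁻¹) ^ (r+1) *
      ∑ T : Fin (r+1) → Wd n k h, ∑ π : Fin (r+1) → Equiv.Perm (Fin k × Fin h),
        ∏ b, a (Kb T π b) := by
  classical
  rw [trace_wp, Finset.mul_sum]
  apply Finset.sum_congr rfl
  intro T _
  have h1 : ∀ l : Fin (r+1), CC (k := k) a l (T (l-1)) (T l) = ((k * h).factorial : ℝ)⁻¹ *
      ∑ π : Equiv.Perm (Fin k × Fin h), ∏ m : Fin k, (if (l : ℕ) % 2 = 0 then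
        a (Fin.append (fun ρ => T (l - 1) (π (m, ρ))) (fun ρ => T l (m, ρ)))
        else a (Fin.append (fun ρ => T l (m, ρ)) (fun ρ => T (l - 1) (π (m, ρ))))) := by
    intro l
    by_cases hl : (l : ℕ) % 2 = 0
    · simp only [CC, hl, if_true, PP_mul]; rfl
    · simp only [CC, hl, if_false, PP_mul]; rfl
  simp only [h1, Finset.prod_mul_distrib, Finset.prod_const, Finset.card_univ, Fintype.card_fin]
  congr 1
  rw [Finset.prod_univ_sum, Fintype.piFinset_univ]
  apply Finset.sum_congr rfl
  intro π _
  rw [Fintype.prod_prod_type]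
  apply Finset.prod_congr rfl
  intro l _
  apply Finset.prod_congr rfl
  intro m _
  simp only [Kb]
  split_ifs <;> rfl

/-- the big permutation of slots -/
def bigPi {k h r : ℕ} (π : Fin (r+1) → Equiv.Perm (Fin k × Fin h)) :
    Equiv.Perm ((Fin (r+1) × Fin k) × Fin h) where
  toFun s := ((s.1.1 - 1, (π s.1.1 (s.1.2, s.2)).1), (π s.1.1 (s.1.2, s.2)).2)
  invFun s := ((s.1.1 + 1, ((π (s.1.1 + 1)).symm (s.1.2, s.2)).1),
    ((π (s.1.1 + 1)).symm (s.1.2, s.2)).2)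
  left_inv s := by rcases s with ⟨⟨l, m⟩, ρ⟩; simp
  right_inv s := by rcases s with ⟨⟨l, m⟩, ρ⟩; simp

lemma bigPi_inj {k h r : ℕ} (π π' : Fin (r+1) → Equiv.Perm (Fin k × Fin h))
    (hh : bigPi π = bigPi π') : π = π' := by
  funext l
  ext1 x
  have := congrArg (fun g => g ((l, x.1), x.2)) hh
  simp only [bigPi, Equiv.coe_fn_mk, Prod.mk.injEq, true_and] at this
  exact Prod.ext this.1 this.2

lemma append_inj' {n h : ℕ} {u v u' v' : Fin h → Fin n} (hh : Fin.append u v = Fin.append u' v') :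
    u = u' ∧ v = v' := by
  have := (Fin.appendEquiv h h).injective (a₁ := (u, v)) (a₂ := (u', v')) hh
  exact ⟨congrArg Prod.fst this, congrArg Prod.snd this⟩


open Classical in
lemma abs_count {X B Ω : Type*} [Fintype X] [Fintype B] [Fintype Ω] (K : X → B → Ω)
    (step : B → ℕ) (m f D : ℕ) (hB : Fintype.card B = 2 * m)
    (hcount : ∀ E : Enc B m, E.Valid step →
      Nat.card {x // ∀ i, K x (E.al i) = K x (E.2 i)} * f ≤ D) :
    (∑ x, ∑ A : Ω → Bool, ∏ b, sgB (A (K x b))) * (f : ℝ) ≤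
      (Fintype.card (Ω → Bool) : ℝ) * ((4 ^ m * (2 * m) ^ m : ℕ) : ℝ) * (D : ℝ) := by
  set cΩ : ℝ := (Fintype.card (Ω → Bool) : ℝ) with hcΩ
  have hc : 0 ≤ cΩ := by positivity
  have h1 : ∀ x : X, ∑ A : Ω → Bool, ∏ b, sgB (A (K x b)) ≤
      cΩ * ∑ E : Enc B m, (if E.Valid step ∧ ∀ i, K x (E.al i) = K x (E.2 i)
          then (1:ℝ) else 0) := by
    intro x
    refine (exp_signs (K x)).trans ?_
    split_ifs with hev
    · obtain ⟨E, hE⟩ := exists_enc (K x) step m hB hev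
      have : (1:ℝ) ≤ ∑ E : Enc B m, (if E.Valid step ∧ ∀ i, K x (E.al i) = K x (E.2 i)
          then (1:ℝ) else 0) := by
        refine le_trans ?_ (Finset.single_le_sum (f := fun E : Enc B m =>
          (if E.Valid step ∧ ∀ i, K x (E.al i) = K x (E.2 i)
          then (1:ℝ) else 0)) (fun E _ => by split_ifs <;> norm_num) (Finset.mem_univ E))
        simp only [if_pos hE, le_refl]
      nlinarith
    · apply mul_nonneg hc
      exact Finset.sum_nonneg (fun E _ => by split_ifs <;> norm_num)
  have h2 : ∀ E : Enc B m,
      (∑ x : X, (if E.Valid step ∧ ∀ i, K x (E.al i) = K x (E.2 i)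
          then (1:ℝ) else 0)) * (f : ℝ) ≤ (D : ℝ) := by
    intro E
    by_cases hE : E.Valid step
    · have := hcount E hE
      rw [Nat.card_eq_fintype_card, Fintype.card_subtype] at this
      simp only [hE, true_and, Finset.sum_boole]
      exact_mod_cast this
    · simp only [hE, false_and, if_false, Finset.sum_const_zero, zero_mul]
      positivity
  calc _ ≤ (∑ x : X, cΩ * ∑ E : Enc B m,
        (if E.Valid step ∧ ∀ i, K x (E.al i) = K x (E.2 i)
          then (1:ℝ) else 0)) * (f : ℝ) := by
          apply mul_le_mul_of_nonneg_right _ (by positivity)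
          exact Finset.sum_le_sum (fun x _ => h1 x)
      _ = cΩ * ∑ E : Enc B m, (∑ x : X,
        (if E.Valid step ∧ ∀ i, K x (E.al i) = K x (E.2 i)
          then (1:ℝ) else 0)) * (f : ℝ) := by
          rw [← Finset.mul_sum, Finset.sum_comm, mul_assoc, Finset.sum_mul]
      _ ≤ cΩ * ∑ E : Enc B m, (D : ℝ) := by
          apply mul_le_mul_of_nonneg_left _ hc
          exact Finset.sum_le_sum (fun E _ => h2 E)
      _ = cΩ * (Fintype.card (Enc B m) : ℝ) * (D : ℝ) := by
          rw [Finset.sum_const, nsmul_eq_mul, Finset.card_univ, mul_assoc]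
      _ ≤ _ := by
          apply mul_le_mul_of_nonneg_right _ (by positivity)
          apply mul_le_mul_of_nonneg_left _ hc
          exact_mod_cast card_enc _ _ hB

lemma core_count' {V Λ : Type*} [Fintype V] [Fintype Λ] {r n : ℕ} (e : Λ ⊕ Λ ≃ V)
    (step : V → Fin (r+1)) (fl : Λ → Prop)
    (hst : ∀ i, step (e (Sum.inl i)) ≤ step (e (Sum.inr i)))
    (X : Type*) (g : X → (V → Fin n) × Equiv.Perm V) (hg : Function.Injective g)
    (hgQ : ∀ x, QQ (fun i => e (Sum.inl i)) (fun i => e (Sum.inr i)) step fl (g x)) :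
    Nat.card X * (Fintype.card Λ).factorial
    ≤ n ^ (Nat.card {s // step s = Fin.last r}) * (Fintype.card V).factorial *
      (n + Fintype.card Λ) ^ (Fintype.card Λ) := by
  classical
  have h := (core_count (n := n) e step fl hst).trans (Nat.mul_le_mul_left _ (sum_fact' n Λ))
  rw [Nat.card_eq_fintype_card (α := {s // step s = Fin.last r})]
  refine le_trans (Nat.mul_le_mul_right _ ?_) h
  rw [← Nat.card_eq_fintype_card]
  exact Nat.card_le_card_of_injective (fun x => (⟨g x, hgQ x⟩ : {x : (V → Fin n) × Equiv.Perm V //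
      QQ (fun i => e (Sum.inl i)) (fun i => e (Sum.inr i)) step fl x}))
    (fun x y hxy => hg (congrArg Subtype.val hxy))

/-- the slot equivalence -/
noncomputable def slotE {B : Type*} {m : ℕ} (h : ℕ) (E : Enc B m)
    (hE : Function.Bijective (Sum.elim E.al E.2)) :
    (Fin m × Fin h) ⊕ (Fin m × Fin h) ≃ B × Fin h :=
  (Equiv.sumProdDistrib _ _ _).symm.trans (Equiv.prodCongr (Equiv.ofBijective _ hE) (Equiv.refl _))

lemma slotE_l {B : Type*} {m : ℕ} (h : ℕ) (E : Enc B m)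
    (hE : Function.Bijective (Sum.elim E.al E.2)) (i ρ) :
    slotE h E hE (Sum.inl (i, ρ)) = (E.al i, ρ) := rfl

lemma slotE_r {B : Type*} {m : ℕ} (h : ℕ) (E : Enc B m)
    (hE : Function.Bijective (Sum.elim E.al E.2)) (i ρ) :
    slotE h E hE (Sum.inr (i, ρ)) = (E.2 i, ρ) := rfl

/-- word and permutation to slots -/
def slotG {n k h r : ℕ}
    (x : (Fin (r+1) → Wd n k h) × (Fin (r+1) → Equiv.Perm (Fin k × Fin h))) :
    ((Fin (r+1) × Fin k) × Fin h → Fin n) × Equiv.Perm ((Fin (r+1) × Fin k) × Fin h) :=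
  (fun s => x.1 s.1.1 (s.1.2, s.2), bigPi x.2)

lemma slotG_inj {n k h r : ℕ} : Function.Injective (slotG (n := n) (k := k) (h := h) (r := r)) := by
  rintro ⟨T, π⟩ ⟨T', π'⟩ hF
  simp only [slotG, Prod.mk.injEq] at hF
  have hT : T = T' := by
    funext l x
    exact congrFun hF.1 ((l, x.1), x.2)
  have hπ := bigPi_inj _ _ hF.2
  rw [hT, hπ]

lemma Kb_cases {n k h r : ℕ} (x : (Fin (r+1) → Wd n k h) × (Fin (r+1) → Equiv.Perm (Fin k × Fin h)))
    (b b' : Fin (r+1) × Fin k) (hK : Kb x.1 x.2 b = Kb x.1 x.2 b') (ρ : Fin h) :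
    ((b.1 : ℕ) % 2 ≠ (b'.1 : ℕ) % 2 →
      (slotG x).1 ((slotG x).2 (b, ρ)) = (slotG x).1 (b', ρ) ∧
      (slotG x).1 (b, ρ) = (slotG x).1 ((slotG x).2 (b', ρ))) ∧
    (¬ (b.1 : ℕ) % 2 ≠ (b'.1 : ℕ) % 2 →
      (slotG x).1 ((slotG x).2 (b, ρ)) = (slotG x).1 ((slotG x).2 (b', ρ)) ∧
      (slotG x).1 (b, ρ) = (slotG x).1 (b', ρ)) := by
  simp only [slotG, bigPi, Equiv.coe_fn_mk, Prod.mk.eta]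
  simp only [Kb] at hK
  refine ⟨fun hf => ?_, fun hf => ?_⟩
  · by_cases h1 : (b.1 : ℕ) % 2 = 0
    · have h2 : (b'.1 : ℕ) % 2 ≠ 0 := fun h => hf (by rw [h1, h])
      rw [if_pos h1, if_neg h2] at hK
      obtain ⟨a1, a2⟩ := append_inj' hK
      exact ⟨congrFun a1 ρ, congrFun a2 ρ⟩
    · have h2 : (b'.1 : ℕ) % 2 = 0 := by omega
      rw [if_neg h1, if_pos h2] at hK
      obtain ⟨a1, a2⟩ := append_inj' hK
      exact ⟨congrFun a2 ρ, congrFun a1 ρ⟩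
  · by_cases h1 : (b.1 : ℕ) % 2 = 0
    · have h2 : (b'.1 : ℕ) % 2 = 0 := by omega
      rw [if_pos h1, if_pos h2] at hK
      obtain ⟨a1, a2⟩ := append_inj' hK
      exact ⟨congrFun a1 ρ, congrFun a2 ρ⟩
    · have h2 : (b'.1 : ℕ) % 2 ≠ 0 := by omega
      rw [if_neg h1, if_neg h2] at hK
      obtain ⟨a1, a2⟩ := append_inj' hK
      exact ⟨congrFun a2 ρ, congrFun a1 ρ⟩

lemma count_enc {n k h r m : ℕ} (E : Enc (Fin (r+1) × Fin k) m)
    (hE : E.Valid (fun b => (b.1 : ℕ))) :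
    Nat.card {x : (Fin (r+1) → Wd n k h) × (Fin (r+1) → Equiv.Perm (Fin k × Fin h)) //
        ∀ i, Kb x.1 x.2 (E.al i) = Kb x.1 x.2 (E.2 i)} * (m * h).factorial
      ≤ n ^ (k * h) * ((r+1) * k * h).factorial * (n + m * h) ^ (m * h) := by
  have hlast : Nat.card {s : (Fin (r+1) × Fin k) × Fin h // s.1.1 = Fin.last r} = k * h := by
    have : {s : (Fin (r+1) × Fin k) × Fin h // s.1.1 = Fin.last r} ≃ Fin k × Fin h :=
      { toFun := fun s => (s.1.1.2, s.1.2)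
        invFun := fun x => ⟨((Fin.last r, x.1), x.2), rfl⟩
        left_inv := by
          rintro ⟨⟨⟨l, m⟩, ρ⟩, hs⟩
          simp only at hs
          subst hs; rfl
        right_inv := fun x => rfl }
    rw [Nat.card_congr this]; simp
  have hΛ : Fintype.card (Fin m × Fin h) = m * h := by simp
  have hV : Fintype.card ((Fin (r+1) × Fin k) × Fin h) = (r+1) * k * h := by simp
  have h := core_count' (n := n) (r := r) (slotE h E hE.1) (fun s => s.1.1)
    (fun i => ((E.al i.1).1 : ℕ) % 2 ≠ ((E.2 i.1).1 : ℕ) % 2)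
    (by rintro ⟨i, ρ⟩; exact hE.2 i)
    {x : (Fin (r+1) → Wd n k h) × (Fin (r+1) → Equiv.Perm (Fin k × Fin h)) //
        ∀ i, Kb x.1 x.2 (E.al i) = Kb x.1 x.2 (E.2 i)}
    (fun x => slotG x.1) (fun x y hxy => Subtype.ext (slotG_inj hxy))
    (by
      rintro ⟨x, hx⟩
      refine ⟨fun s => rfl, ?_⟩
      rintro ⟨i, ρ⟩
      exact Kb_cases x _ _ (hx i) ρ)
  rw [hΛ, hV, hlast] at h
  exact h

lemma exp_trace {n k h p : ℕ} (hp : p ≠ 0) :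
    (∑ A : (Fin (h+h) → Fin n) → Bool,
      (wp (CC (k := k) (fun K => sgB (A K))) (2 * p)).trace) * ((p * k * h).factorial : ℝ) ≤
    (((k * h).factorial : ℝ)⁻¹) ^ (2 * p) * (Fintype.card ((Fin (h+h) → Fin n) → Bool) : ℝ) *
      ((4 ^ (p * k) * (2 * (p * k)) ^ (p * k) : ℕ) : ℝ) *
      ((n ^ (k * h) * (2 * p * k * h).factorial * (n + p * k * h) ^ (p * k * h) : ℕ) : ℝ) := by
  obtain ⟨r, hr⟩ : ∃ r, 2 * p = r + 1 := ⟨2 * p - 1, by omega⟩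
  rw [hr]
  simp only [trace_expand]
  rw [← Finset.mul_sum]
  have hBc : Fintype.card (Fin (r+1) × Fin k) = 2 * (p * k) := by
    simp only [Fintype.card_prod, Fintype.card_fin]; rw [← hr]; ring
  have h3 := abs_count (X := (Fin (r+1) → Wd n k h) × (Fin (r+1) → Equiv.Perm (Fin k × Fin h)))
    (fun x => Kb x.1 x.2) (fun b => (b.1 : ℕ)) (p * k) _ _ hBc (fun E hE => count_enc E hE)
  rw [Finset.sum_comm] at h3
  simp only [Fintype.sum_prod_type] at h3
  have h4 := mul_le_mul_of_nonneg_left h3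
    (show (0:ℝ) ≤ (((k * h).factorial : ℝ)⁻¹) ^ (r + 1) by positivity)
  refine le_trans (le_of_eq ?_) (h4.trans (le_of_eq ?_))
  · rw [← mul_assoc]; congr!
  · simp only [← mul_assoc]; congr!

open Matrix in
lemma PP_mulVec {n k h : ℕ} (x : Fin n → ℝ) :
    PP n k h *ᵥ (fun I : Wd n k h => ∏ s, x (I s)) = fun I => ∏ s, x (I s) := by
  classical
  funext I
  simp only [mulVec, dotProduct, PP, mul_assoc, ← Finset.mul_sum, Finset.sum_mul]
  rw [Finset.sum_comm]
  simp only [ite_mul, one_mul, zero_mul, Finset.sum_ite_eq, Finset.mem_univ, if_true]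
  have : ∀ π : Equiv.Perm (Fin k × Fin h), ∏ s, x ((I ∘ π) s) = ∏ s, x (I s) := fun π =>
    Equiv.prod_comp π (fun s => x (I s))
  simp only [this, Finset.sum_const, Finset.card_univ, Fintype.card_perm, Fintype.card_prod,
    Fintype.card_fin, nsmul_eq_mul]
  rw [← mul_assoc, inv_mul_cancel₀ (by positivity), one_mul]

/-- the split of a pair of words -/
def splitE (n k h : ℕ) :
    Wd n k h × Wd n k h ≃ (Fin k → (Fin h → Fin n) × (Fin h → Fin n)) where
  toFun w m := (fun r => w.1 (m, r), fun r => w.2 (m, r))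
  invFun g := (fun s => (g s.1).1 s.2, fun s => (g s.1).2 s.2)
  left_inv w := rfl
  right_inv g := rfl

lemma rep_kron {n k h : ℕ} (a : (Fin (h+h) → Fin n) → ℝ) (x : Fin n → ℝ) :
    (∑ K : Fin (h+h) → Fin n, a K * ∏ ℓ, x (K ℓ)) ^ k =
      ∑ I : Wd n k h, ∑ J : Wd n k h, kron a I J * (∏ s, x (I s)) * ∏ s, x (J s) := by
  rw [← Equiv.sum_comp (Fin.appendEquiv h h)]
  have h1 : (∑ w : (Fin h → Fin n) × (Fin h → Fin n), a (Fin.appendEquiv h h w) *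
      ∏ ℓ, x ((Fin.appendEquiv h h w) ℓ)) ^ k = ∏ _m : Fin k,
      ∑ w : (Fin h → Fin n) × (Fin h → Fin n), a (Fin.append w.1 w.2) *
      ((∏ ℓ, x (w.1 ℓ)) * ∏ ℓ, x (w.2 ℓ)) := by
    rw [Finset.prod_const, Finset.card_univ, Fintype.card_fin]
    congr 1
    apply Finset.sum_congr rfl
    intro w _
    simp only [Fin.appendEquiv, Equiv.coe_fn_mk, Fin.prod_univ_add, Fin.append_left, Fin.append_right]
  rw [h1, Finset.prod_univ_sum, Fintype.piFinset_univ, ← Equiv.sum_comp (splitE n k h),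
    Fintype.sum_prod_type]
  apply Finset.sum_congr rfl
  intro I _
  apply Finset.sum_congr rfl
  intro J _
  simp only [kron, splitE, Equiv.coe_fn_mk, Finset.prod_mul_distrib, Fintype.prod_prod_type]
  rw [mul_assoc]

/-- The symmetrized matrix -/
noncomputable def MS {n k h : ℕ} (a : (Fin (h+h) → Fin n) → ℝ) : Matrix (Wd n k h) (Wd n k h) ℝ :=
  PP n k h * kron a * PP n k h

open Matrix in
lemma quad_sum {ι : Type*} [Fintype ι] (Z : Matrix ι ι ℝ) (X : ι → ℝ) :
    ∑ I, ∑ J, Z I J * X I * X J = X ⬝ᵥ (Z *ᵥ X) := by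
  simp only [dotProduct, mulVec, Finset.mul_sum]
  apply Finset.sum_congr rfl; intro I _
  apply Finset.sum_congr rfl; intro J _
  ring

open Matrix in
lemma rep_MS {n k h : ℕ} (a : (Fin (h+h) → Fin n) → ℝ) (x : Fin n → ℝ) :
    (∑ K : Fin (h+h) → Fin n, a K * ∏ ℓ, x (K ℓ)) ^ k =
      ∑ I : Wd n k h, ∑ J : Wd n k h, MS a I J * (∏ s, x (I s)) * ∏ s, x (J s) := by
  rw [rep_kron, quad_sum (kron a) (fun I : Wd n k h => ∏ s, x (I s)),
    quad_sum (MS a) (fun I : Wd n k h => ∏ s, x (I s)), MS, ← mulVec_mulVec, PP_mulVec,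
    ← mulVec_mulVec, dotProduct_mulVec _ (PP n k h), ← mulVec_transpose, PP_symm, PP_mulVec]

open Matrix in
lemma good_exists {n k h Q : ℕ} (ε : Fin Q ≃ Fin k × Fin h) (a : (Fin (h+h) → Fin n) → ℝ) (t : ℝ)
    (hgood : ∀ y : Wd n k h → ℝ, y ⬝ᵥ y = 1 → y ⬝ᵥ (MS a *ᵥ y) ≤ t) :
    ∃ M : (Fin Q → Fin n) → (Fin Q → Fin n) → ℝ,
      (∀ I J, M I J = M J I) ∧
      (∀ x : Fin n → ℝ, (∑ K : Fin (h+h) → Fin n, a K * ∏ ℓ, x (K ℓ)) ^ k =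
          ∑ I : Fin Q → Fin n, ∑ J : Fin Q → Fin n,
            M I J * (∏ ℓ, x (I ℓ)) * ∏ ℓ, x (J ℓ)) ∧
      (∀ y : EuclideanSpace ℝ (Fin Q → Fin n), ‖y‖ = 1 → ∑ I, ∑ J, y I * M I J * y J ≤ t) := by
  let η : Wd n k h ≃ (Fin Q → Fin n) := Equiv.arrowCongr ε.symm (Equiv.refl _)
  have hη : ∀ (x : Fin n → ℝ) (I : Wd n k h), ∏ ℓ, x (η I ℓ) = ∏ s, x (I s) := fun x I =>
    Equiv.prod_comp ε (fun s => x (I s))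
  have key : ∀ X : (Fin Q → Fin n) → ℝ, ∑ I, ∑ J,
      ((MS a (η.symm I) (η.symm J) + MS a (η.symm J) (η.symm I)) / 2) * X I * X J
      = ∑ I, ∑ J, MS a I J * X (η I) * X (η J) := by
    intro X
    rw [← Equiv.sum_comp η]
    have : ∀ I : Wd n k h, ∑ J, ((MS a (η.symm (η I)) (η.symm J) + MS a (η.symm J) (η.symm (η I))) / 2)
        * X (η I) * X J = ∑ J, ((MS a I J + MS a J I) / 2) * X (η I) * X (η J) := by
      intro I
      rw [← Equiv.sum_comp η]
      simp
    simp only [this]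
    have h2 : ∑ I, ∑ J, MS a J I * X (η I) * X (η J) = ∑ I, ∑ J, MS a I J * X (η I) * X (η J) := by
      rw [Finset.sum_comm]
      apply Finset.sum_congr rfl; intro I _
      apply Finset.sum_congr rfl; intro J _
      ring
    have h3 : ∑ I, ∑ J, ((MS a I J + MS a J I) / 2) * X (η I) * X (η J) =
        (∑ I, ∑ J, MS a I J * X (η I) * X (η J)) / 2
        + (∑ I, ∑ J, MS a J I * X (η I) * X (η J)) / 2 := by
      simp only [Finset.sum_div, ← Finset.sum_add_distrib]
      apply Finset.sum_congr rfl; intro I _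
      apply Finset.sum_congr rfl; intro J _
      ring
    rw [h3, h2]; ring
  refine ⟨fun I J => (MS a (η.symm I) (η.symm J) + MS a (η.symm J) (η.symm I)) / 2, ?_, ?_, ?_⟩
  · intro I J; ring
  · intro x
    rw [rep_MS, key]
    simp only [hη]
  · intro y hy
    have h1 : (fun I => y (η I)) ⬝ᵥ (fun I : Wd n k h => y (η I)) = 1 := by
      have h2 : ‖y‖ ^ 2 = 1 := by rw [hy]; norm_num
      rw [EuclideanSpace.real_norm_sq_eq] at h2
      rw [← h2, dotProduct, ← Equiv.sum_comp η]
      simp [sq]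
    have h2 := hgood _ h1
    rw [← quad_sum, ← key (fun I => y I)] at h2
    refine le_trans (le_of_eq ?_) h2
    apply Finset.sum_congr rfl; intro I _
    apply Finset.sum_congr rfl; intro J _
    ring

open Matrix in
lemma bad_count {n k h : ℕ} (j : ℕ) (t : ℝ) (ht : 0 ≤ t) :
    (Nat.card {A : (Fin (h+h) → Fin n) → Bool // ¬ ∀ y : Wd n k h → ℝ, y ⬝ᵥ y = 1 →
      y ⬝ᵥ (MS (fun K => sgB (A K)) *ᵥ y) ≤ t} : ℝ) * t ^ (2 * 2 ^ j) ≤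
    ∑ A : (Fin (h+h) → Fin n) → Bool,
      (wp (CC (k := k) (fun K => sgB (A K))) (2 * 2 ^ j)).trace := by
  classical
  rw [Nat.card_eq_fintype_card, Fintype.card_subtype, ← nsmul_eq_mul, ← Finset.sum_const]
  have hnn : ∀ A : (Fin (h+h) → Fin n) → Bool,
      0 ≤ (wp (CC (k := k) (fun K => sgB (A K))) (2 * 2 ^ j)).trace := by
    intro A
    rw [← trace_MM _ _ (by positivity)]
    have := (Matrix.posSemidef_self_mul_conjTranspose (MS (k := k) (fun K => sgB (A K)))).pow (2^j)
    rw [conjTranspose_eq_transpose_of_trivial] at this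
    exact this.trace_nonneg
  refine le_trans (Finset.sum_le_sum ?_)
    (Finset.sum_le_sum_of_subset_of_nonneg (Finset.subset_univ _) (fun A _ _ => hnn A))
  intro A hA
  simp only [Finset.mem_filter, Finset.mem_univ, true_and] at hA
  push Not at hA
  obtain ⟨y, hy, hlt⟩ := hA
  rw [← trace_MM _ _ (by positivity)]
  exact (pow_le_pow_left₀ ht hlt.le _).trans (quad_trace _ y hy j)

open Matrix in
lemma good_zero {n h : ℕ} (a : (Fin (h+h) → Fin n) → ℝ) (y : Wd n 0 h → ℝ) (hy : y ⬝ᵥ y = 1) :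
    y ⬝ᵥ (MS a *ᵥ y) ≤ 1 := by
  have h1 := rep_MS (k := 0) a (fun _ => 1)
  simp only [pow_zero, Finset.prod_const_one, mul_one, Fintype.sum_unique] at h1
  simp only [dotProduct, Fintype.sum_unique] at hy
  simp only [dotProduct, mulVec, Fintype.sum_unique, ← h1, one_mul, hy, le_refl]

lemma fact_mul_le (m N : ℕ) : (m * N).factorial ≤ m ^ (m * N) * N.factorial ^ m := by
  induction N with
  | zero => simp
  | succ N ih =>
    rw [Nat.mul_succ, ← Nat.factorial_mul_ascFactorial]
    calc (m * N).factorial * (m * N + 1).ascFactorial m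
        ≤ (m ^ (m * N) * N.factorial ^ m) * (m * (N + 1)) ^ m := by
          apply Nat.mul_le_mul ih
          refine (Nat.ascFactorial_le_pow_add _ _).trans (le_of_eq ?_)
          ring
      _ = m ^ (m * N + m) * (N + 1).factorial ^ m := by
          rw [Nat.factorial_succ, mul_pow, mul_pow]; ring

lemma pow_le_fact (L : ℕ) : (L : ℝ) ^ L ≤ Real.exp 1 ^ L * (L.factorial : ℝ) := by
  have := Real.pow_div_factorial_le_exp (L : ℝ) (by positivity) L
  rw [div_le_iff₀ (by positivity)] at this
  rw [← Real.exp_nat_mul, mul_one]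
  exact this

lemma num_trace {n k h p : ℕ} (T cΩ : ℝ) (hp : 1 ≤ p) (hk : 1 ≤ k) (hh : 1 ≤ h)
    (hn : k * h ≤ n) (hc : 0 ≤ cΩ)
    (hT : T * ((p * k * h).factorial : ℝ) ≤ (((k * h).factorial : ℝ)⁻¹) ^ (2 * p) * cΩ *
      ((4 ^ (p * k) * (2 * (p * k)) ^ (p * k) : ℕ) : ℝ) *
      ((n ^ (k * h) * (2 * p * k * h).factorial * (n + p * k * h) ^ (p * k * h) : ℕ) : ℝ)) :
    T ≤ cΩ * (n : ℝ) ^ (k * h) *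
      (8 * p * k * (8 * Real.exp 1 * p ^ 2 * n / (k * h)) ^ h) ^ (p * k) := by
  set L := p * k * h with hL
  have hLpos : (0:ℝ) < L := by rw [hL]; positivity
  have hf : (0:ℝ) < (L.factorial : ℝ) := by positivity
  have hN : (0:ℝ) < ((k * h).factorial : ℝ) := by positivity
  have h1 : ((2 * p * k * h).factorial : ℝ) ≤ (2 * p : ℝ) ^ (2 * L) * ((k*h).factorial : ℝ) ^ (2 * p) := by
    have := fact_mul_le (2 * p) (k * h)
    rw [show 2 * p * (k * h) = 2 * L by rw [hL]; ring] at this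
    rw [show 2 * p * k * h = 2 * L by rw [hL]; ring]
    exact_mod_cast this
  have h2 : ((n + L : ℕ) : ℝ) ≤ 2 * n * p := by
    have : n + L ≤ 2 * n * p := by
      have a1 : n * 1 ≤ n * p := Nat.mul_le_mul_left _ hp
      have a2 : p * (k * h) ≤ p * n := Nat.mul_le_mul_left _ hn
      rw [hL]; nlinarith
    exact_mod_cast this
  have h3 : T * (L.factorial : ℝ) ≤ cΩ * (8 * p * k : ℝ) ^ (p * k) * n ^ (k * h) *
      ((2 * p : ℝ) ^ (2 * L) * (2 * n * p : ℝ) ^ L) := by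
    refine hT.trans ?_
    push_cast
    calc _ ≤ (((k * h).factorial : ℝ)⁻¹) ^ (2 * p) * cΩ *
        (4 ^ (p * k) * (2 * (p * k)) ^ (p * k)) *
        (n ^ (k * h) * ((2 * p : ℝ) ^ (2 * L) * ((k*h).factorial : ℝ) ^ (2 * p)) *
          (2 * n * p : ℝ) ^ L) := by
          push_cast at h2
          gcongr
      _ = _ := by
          have e1 : (((k * h).factorial : ℝ)⁻¹) ^ (2 * p) * ((k*h).factorial : ℝ) ^ (2 * p) = 1 := by
            rw [← mul_pow, inv_mul_cancel₀ hN.ne', one_pow]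
          have e2 : (4:ℝ) ^ (p * k) * (2 * (p * k)) ^ (p * k) = (8 * p * k) ^ (p * k) := by
            rw [← mul_pow]; congr 1; ring
          rw [e2]
          calc _ = ((((k * h).factorial : ℝ)⁻¹) ^ (2 * p) * ((k*h).factorial : ℝ) ^ (2 * p)) *
              (cΩ * (8 * p * k : ℝ) ^ (p * k) * n ^ (k * h) *
              ((2 * p : ℝ) ^ (2 * L) * (2 * n * p : ℝ) ^ L)) := by ring
            _ = _ := by rw [e1, one_mul]
  have h4 : ((2 * p : ℝ) ^ (2 * L) * (2 * n * p : ℝ) ^ L) ≤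
      (8 * Real.exp 1 * p ^ 2 * n / (k * h)) ^ L * (L.factorial : ℝ) := by
    have e1 : ((2 * p : ℝ) ^ (2 * L) * (2 * n * p : ℝ) ^ L) =
        (8 * p ^ 2 * n / (k * h)) ^ L * (L : ℝ) ^ L := by
      rw [pow_mul, ← mul_pow, ← mul_pow]
      congr 1
      rw [hL]; push_cast
      have : (k:ℝ) ≠ 0 := by positivity
      have : (h:ℝ) ≠ 0 := by positivity
      field_simp
      ring
    rw [e1]
    calc _ ≤ (8 * p ^ 2 * n / (k * h) : ℝ) ^ L * (Real.exp 1 ^ L * (L.factorial : ℝ)) := by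
          gcongr; exact pow_le_fact L
      _ = _ := by
          rw [← mul_assoc, ← mul_pow]; congr 2; ring
  have h5 : T * (L.factorial : ℝ) ≤ (cΩ * (n : ℝ) ^ (k * h) *
      (8 * p * k * (8 * Real.exp 1 * p ^ 2 * n / (k * h)) ^ h) ^ (p * k)) * (L.factorial : ℝ) := by
    refine h3.trans ((mul_le_mul_of_nonneg_left h4 (by positivity)).trans (le_of_eq ?_))
    rw [mul_pow (8 * p * k : ℝ), ← pow_mul, show h * (p * k) = L by rw [hL]; ring]
    ring
  exact le_of_mul_le_mul_right h5 hf

/-- the constant -/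
noncomputable def Cst (h : ℕ) : ℝ := 16 * (64 * Real.exp 1) ^ h * Real.exp 1 ^ (h + 1)

lemma one_le_exp1 : (1:ℝ) ≤ Real.exp 1 := Real.one_le_exp (by norm_num)

lemma one_le_Cst (h : ℕ) : 1 ≤ Cst h := by
  have e := one_le_exp1
  have h1 : (1:ℝ) ≤ (64 * Real.exp 1) ^ h := one_le_pow₀ (by linarith)
  have h2 : (1:ℝ) ≤ Real.exp 1 ^ (h+1) := one_le_pow₀ e
  unfold Cst
  nlinarith

lemma tau_sq (n h k : ℕ) (hn : 3 ≤ n) (hk : 1 ≤ k) (hh : 1 ≤ h) (C ℓ : ℝ) (hℓ : 0 < ℓ) :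
    (C * (n : ℝ) ^ (((h + h : ℕ) : ℝ) / 4) * ℓ ^ (((h + h : ℕ) : ℝ) + 1 / 2) /
      (((h + h) * k : ℕ) : ℝ) ^ (((h + h : ℕ) : ℝ) / 4 - 1 / 2)) ^ 2 =
    C ^ 2 * (n : ℝ) ^ h * ℓ ^ (4 * h + 1) * (2 * h * k) / (2 * h * k : ℝ) ^ h := by
  have hn0 : (0:ℝ) < n := by positivity
  have hq : (((h + h) * k : ℕ) : ℝ) = 2 * h * k := by push_cast; ring
  rw [hq]
  set Z : ℝ := 2 * h * k with hZ
  have hZ0 : 0 < Z := by rw [hZ]; positivity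
  have e1 : ((n : ℝ) ^ (((h + h : ℕ) : ℝ) / 4)) ^ 2 = (n:ℝ) ^ h := by
    rw [← Real.rpow_natCast, ← Real.rpow_mul hn0.le, ← Real.rpow_natCast]
    congr 1; push_cast; ring
  have e2 : (ℓ ^ (((h + h : ℕ) : ℝ) + 1 / 2)) ^ 2 = ℓ ^ (4 * h + 1) := by
    rw [← Real.rpow_natCast, ← Real.rpow_mul hℓ.le, ← Real.rpow_natCast]
    congr 1; push_cast; ring
  have e3 : (Z ^ (((h + h : ℕ) : ℝ) / 4 - 1 / 2)) ^ 2 = Z ^ h / Z := by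
    rw [← Real.rpow_natCast, ← Real.rpow_mul hZ0.le, ← Real.rpow_natCast Z h,
      ← Real.rpow_sub_one hZ0.ne']
    congr 1; push_cast; ring
  rw [div_pow, mul_pow, mul_pow, e1, e2, e3, div_div_eq_mul_div]

lemma num_bracket (n h k p : ℕ) (hk : 1 ≤ k) (hh : 1 ≤ h) (ℓ : ℝ) (hℓ : 1 ≤ ℓ)
    (hp : (p:ℝ) ≤ 2 * ℓ) :
    (8 * p * k * (8 * Real.exp 1 * p ^ 2 * n / (k * h)) ^ h) * Real.exp 1 ^ (h + 1) ≤
    Cst h ^ 2 * (n : ℝ) ^ h * ℓ ^ (4 * h + 1) * (2 * h * k) / (2 * h * k : ℝ) ^ h := by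
  have hk' : (1:ℝ) ≤ k := by exact_mod_cast hk
  have hh' : (1:ℝ) ≤ h := by exact_mod_cast hh
  have e := one_le_exp1
  have hC := one_le_Cst h
  have hC2 : Cst h ≤ Cst h ^ 2 := by nlinarith
  have hp0 : (0:ℝ) ≤ p := by positivity
  have h1 : (8 * p * k * (8 * Real.exp 1 * p ^ 2 * n / (k * h)) ^ h) * Real.exp 1 ^ (h + 1) ≤
      (8 * (2 * ℓ) * k * (8 * Real.exp 1 * (2 * ℓ) ^ 2 * n / (k * h)) ^ h) * Real.exp 1 ^ (h + 1) := by
    gcongr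
  have h2 : (8 * (2 * ℓ) * k * (8 * Real.exp 1 * (2 * ℓ) ^ 2 * n / (k * h)) ^ h) * Real.exp 1 ^ (h + 1)
      = Cst h * (n : ℝ) ^ h * ℓ ^ (2 * h + 1) * k / (2 * h * k : ℝ) ^ h := by
    rw [show (8 * Real.exp 1 * (2 * ℓ) ^ 2 * n / (k * h) : ℝ) =
      (64 * Real.exp 1) * ℓ ^ 2 * n / (2 * h * k) by field_simp; ring]
    rw [div_pow, mul_pow, mul_pow, Cst, ← pow_mul]
    ring
  rw [h2] at h1
  refine h1.trans ?_
  have h3 : ℓ ^ (2 * h + 1) ≤ ℓ ^ (4 * h + 1) := pow_le_pow_right₀ hℓ (by omega)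
  have h4 : (k:ℝ) ≤ 2 * h * k := by nlinarith
  gcongr

lemma one_le_log (n : ℕ) (hn : 3 ≤ n) : 1 ≤ Real.log n := by
  rw [Real.le_log_iff_exp_le (by positivity)]
  have := Real.exp_one_lt_three
  have h3 : (3:ℝ) ≤ n := by exact_mod_cast hn
  linarith

lemma exists_j (n : ℕ) (hn : 3 ≤ n) : ∃ j : ℕ, Real.log n ≤ ((2 ^ j : ℕ) : ℝ) ∧
    ((2 ^ j : ℕ) : ℝ) ≤ 2 * Real.log n := by
  obtain ⟨m, h1, h2⟩ := exists_nat_pow_near (one_le_log n hn) (show (1:ℝ) < 2 by norm_num)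
  refine ⟨m + 1, ?_, ?_⟩
  · push_cast; exact h2.le
  · push_cast; rw [pow_succ]; linarith

open Matrix in
lemma bad_bound {n k h : ℕ} (hn : 3 ≤ n) (hk : 1 ≤ k) (hh : 1 ≤ h) (hq : (h + h) * k ≤ n) (τ : ℝ)
    (hτ : 0 < τ) (hτ2 : τ ^ 2 = Cst h ^ 2 * (n : ℝ) ^ h * Real.log n ^ (4 * h + 1) * (2 * h * k)
      / (2 * h * k : ℝ) ^ h) :
    (Nat.card {A : (Fin (h+h) → Fin n) → Bool // ¬ ∀ y : Wd n k h → ℝ, y ⬝ᵥ y = 1 →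
      y ⬝ᵥ (MS (fun K => sgB (A K)) *ᵥ y) ≤ τ ^ k} : ℝ) * n ≤
      (Fintype.card ((Fin (h+h) → Fin n) → Bool) : ℝ) := by
  obtain ⟨j, hj1, hj2⟩ := exists_j n hn
  set p := 2 ^ j with hp
  have hp1 : 1 ≤ p := Nat.one_le_two_pow
  have hℓ := one_le_log n hn
  set ℓ := Real.log n with hℓd
  have hb := bad_count (n := n) (k := k) (h := h) j (τ ^ k) (by positivity)
  rw [← hp] at hb
  set bad : ℝ := (Nat.card {A : (Fin (h+h) → Fin n) → Bool // ¬ ∀ y : Wd n k h → ℝ, y ⬝ᵥ y = 1 →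
      y ⬝ᵥ (MS (fun K => sgB (A K)) *ᵥ y) ≤ τ ^ k} : ℝ)
  set cΩ : ℝ := (Fintype.card ((Fin (h+h) → Fin n) → Bool) : ℝ)
  have hcΩ : 0 ≤ cΩ := by positivity
  have hT := num_trace (n := n) (k := k) (h := h) (p := p) _ cΩ hp1 hk hh (by nlinarith) hcΩ
    (exp_trace (by omega))
  have hbr := num_bracket n h k p hk hh ℓ hℓ hj2
  rw [← hτ2] at hbr
  set br : ℝ := (8 * p * k * (8 * Real.exp 1 * p ^ 2 * n / (k * h)) ^ h) with hbrd
  have hbr0 : 0 ≤ br := by positivity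
  have hn1 : (1:ℝ) ≤ n := by exact_mod_cast (by omega : 1 ≤ n)
  have h1 : (n : ℝ) ^ (k * h) * n ≤ (Real.exp 1 ^ (h+1)) ^ (p * k) := by
    calc (n : ℝ) ^ (k * h) * n = (n:ℝ) ^ (k * h + 1) := by ring
      _ ≤ (n:ℝ) ^ (k * (h+1)) := pow_le_pow_right₀ hn1 (by nlinarith)
      _ = Real.exp ℓ ^ (k * (h+1)) := by rw [hℓd, Real.exp_log (by linarith)]
      _ ≤ Real.exp p ^ (k * (h+1)) := by
          gcongr
      _ = _ := by
          rw [← Real.exp_nat_mul, ← pow_mul, ← Real.exp_nat_mul]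
          congr 1; push_cast; ring
  have h2 : bad * n * τ ^ (2 * (p * k)) ≤ cΩ * τ ^ (2 * (p * k)) := by
    calc bad * n * τ ^ (2 * (p * k)) = (bad * (τ ^ k) ^ (2 * p)) * n := by
          rw [← pow_mul, show k * (2 * p) = 2 * (p * k) by ring]; ring
      _ ≤ (cΩ * (n : ℝ) ^ (k * h) * br ^ (p * k)) * n := by
          exact mul_le_mul_of_nonneg_right (hb.trans hT) (by linarith)
      _ = cΩ * br ^ (p * k) * ((n : ℝ) ^ (k * h) * n) := by ring
      _ ≤ cΩ * br ^ (p * k) * (Real.exp 1 ^ (h+1)) ^ (p * k) := by gcongr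
      _ = cΩ * (br * Real.exp 1 ^ (h+1)) ^ (p * k) := by rw [mul_pow]; ring
      _ ≤ cΩ * (τ ^ 2) ^ (p * k) := by gcongr
      _ = _ := by rw [← pow_mul]
  exact le_of_mul_le_mul_right h2 (by positivity)

lemma prob_le {Ω : Type*} [Fintype Ω] [Nonempty Ω] (G P : Ω → Prop) (hGP : ∀ A, G A → P A)
    (δ : ℝ) (hbad : (Nat.card {A // ¬ G A} : ℝ) ≤ δ * Fintype.card Ω) :
    1 - δ ≤ (Nat.card {A // P A} : ℝ) / (Fintype.card Ω : ℝ) := by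
  classical
  have hc : (0:ℝ) < Fintype.card Ω := by exact_mod_cast Fintype.card_pos
  rw [le_div_iff₀ hc]
  have h1 : Nat.card {A // G A} ≤ Nat.card {A // P A} :=
    Nat.card_le_card_of_injective (fun x => (⟨x.1, hGP _ x.2⟩ : {A // P A}))
      (fun x y h => Subtype.ext (congrArg (fun z => z.1) h))
  have h2 : Nat.card {A // G A} + Nat.card {A // ¬ G A} = Fintype.card Ω := by
    rw [← Nat.card_sum, Nat.card_congr (Equiv.sumCompl G), Nat.card_eq_fintype_card]
  have h1' : (Nat.card {A // G A} : ℝ) ≤ Nat.card {A // P A} := by exact_mod_cast h1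
  have h2' : (Nat.card {A // G A} : ℝ) + Nat.card {A // ¬ G A} = Fintype.card Ω := by
    exact_mod_cast h2
  linarith

theorem stmt_1 (d : ℕ) (hd2 : 2 ≤ d) (hde : d % 2 = 0) :
    ∃ C c : ℝ, 0 < C ∧ 0 < c ∧
      ∀ n q : ℕ, 3 ≤ n → q % 2 = 0 → d ∣ q → q ≤ n →
        1 - (n : ℝ) ^ (-c) ≤
          tprob n d (fun A =>
            ∃ M : (Fin (q / 2) → Fin n) → (Fin (q / 2) → Fin n) → ℝ,
              (∀ I J, M I J = M J I) ∧
              (∀ x : Fin n → ℝ,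
                (∑ K : Fin d → Fin n, A K * ∏ ℓ, x (K ℓ)) ^ (q / d) =
                  ∑ I : Fin (q / 2) → Fin n, ∑ J : Fin (q / 2) → Fin n,
                    M I J * (∏ ℓ, x (I ℓ)) * ∏ ℓ, x (J ℓ)) ∧
              (∀ y : EuclideanSpace ℝ (Fin (q / 2) → Fin n), ‖y‖ = 1 →
                ∑ I, ∑ J, y I * M I J * y J ≤
                  (C * (n : ℝ) ^ ((d : ℝ) / 4) * Real.log n ^ ((d : ℝ) + 1 / 2) /
                    (q : ℝ) ^ ((d : ℝ) / 4 - 1 / 2)) ^ ((q : ℝ) / (d : ℝ)))) := by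
  obtain ⟨h, rfl⟩ : ∃ h, d = h + h := ⟨d / 2, by omega⟩
  have hh : 1 ≤ h := by omega
  refine ⟨Cst h, 1, lt_of_lt_of_le one_pos (one_le_Cst h), one_pos, ?_⟩
  intro n q hn _ hdq hqn
  obtain ⟨k, rfl⟩ := hdq
  have e1 : (h + h) * k / (h + h) = k := Nat.mul_div_cancel_left k (by omega)
  have e2 : (h + h) * k / 2 = k * h := by
    rw [show (h + h) * k = 2 * (k * h) by ring]; exact Nat.mul_div_cancel_left _ (by norm_num)
  have e3 : (((h + h) * k : ℕ) : ℝ) / ((h + h : ℕ) : ℝ) = k := by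
    have : ((h + h : ℕ) : ℝ) ≠ 0 := by positivity
    rw [Nat.cast_mul, mul_div_cancel_left₀ _ this]
  rw [e1, e3]
  have ε : Fin ((h + h) * k / 2) ≃ Fin k × Fin h := Fintype.equivOfCardEq (by simp [e2])
  have hlog := one_le_log n hn
  have hn0 : (0:ℝ) < n := by positivity
  set τ : ℝ := (Cst h * (n : ℝ) ^ (((h + h : ℕ) : ℝ) / 4) *
    Real.log n ^ (((h + h : ℕ) : ℝ) + 1 / 2) /
      (((h + h) * k : ℕ) : ℝ) ^ (((h + h : ℕ) : ℝ) / 4 - 1 / 2)) with hτd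
  rw [Real.rpow_natCast τ k]
  unfold tprob
  refine prob_le (fun A : (Fin (h+h) → Fin n) → Bool => ∀ y : Wd n k h → ℝ, dotProduct y y = 1 →
      dotProduct y ((MS (fun K => sgB (A K))).mulVec y) ≤ τ ^ k) _ ?_ _ ?_
  · intro A hA
    exact good_exists ε (signT A) (τ ^ k) hA
  · rw [Real.rpow_neg_one, inv_mul_eq_div, le_div_iff₀ hn0]
    rcases Nat.eq_zero_or_pos k with hk | hk
    · subst hk
      have : IsEmpty {A : (Fin (h+h) → Fin n) → Bool // ¬ ∀ y : Wd n 0 h → ℝ, dotProduct y y = 1 →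
          dotProduct y ((MS (fun K => sgB (A K))).mulVec y) ≤ τ ^ 0} :=
        ⟨fun A => A.2 (fun y hy => (good_zero _ y hy).trans (le_of_eq (pow_zero τ).symm))⟩
      rw [Nat.card_of_isEmpty]
      simp only [Nat.cast_zero, zero_mul]
      positivity
    · have hC : 0 < Cst h := lt_of_lt_of_le one_pos (one_le_Cst h)
      have hl : 0 < Real.log n := by linarith
      have hτ : 0 < τ := by
        have : (0:ℝ) < (((h + h) * k : ℕ) : ℝ) := by
          have : 0 < (h + h) * k := by positivity
          exact_mod_cast this
        rw [hτd]; positivity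
      exact bad_bound hn hk hh hqn τ hτ (tau_sq n h k hn hk hh _ _ hl)
end

section
/- Let d ≥ 2 be even. There exist constants C_d, c_d > 0 (depending only on d) such that for all n ≥ 3 and all q of the form q = 2^k·d (k ≥ 1) with q ≤ n, the following holds with probability at least 1 − n^{−c_d} over the random d-tensor A with i.i.d. entries uniform on {−1,+1}: every degree-q sphere pseudo-expectation Ẽ satisfies Ẽ(f) ≤ C_d · n^{d/4} · (log n)^{d+1/2} / q^{d/4−1/2}, where f(x) = Σ_{K∈[n]^d} A_K x^K. -/
open scoped BigOperators

section KK
open Matrix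
set_option linter.unusedSectionVars false
set_option linter.unusedSimpArgs false
variable {ι κ : Type*} [Fintype ι] [DecidableEq ι] [Fintype κ] [DecidableEq κ]

theorem kk_spec (X : Matrix ι ι ℝ) (hX : Xᵀ = X) :
    ∃ (U : Matrix ι ι ℝ) (l : ι → ℝ), Uᵀ * U = 1 ∧ U * Uᵀ = 1 ∧
      ∀ s : ℕ, X ^ s = U * diagonal (fun i => l i ^ s) * Uᵀ := by
  have hH : X.IsHermitian := by
    rw [Matrix.IsHermitian, conjTranspose_eq_transpose_of_trivial, hX]
  have h1 : ((hH.eigenvectorUnitary : Matrix ι ι ℝ))ᵀ * (hH.eigenvectorUnitary : Matrix ι ι ℝ) = 1 := by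
    have := Unitary.coe_star_mul_self hH.eigenvectorUnitary
    rwa [star_eq_conjTranspose, conjTranspose_eq_transpose_of_trivial] at this
  have h2 : ((hH.eigenvectorUnitary : Matrix ι ι ℝ)) * (hH.eigenvectorUnitary : Matrix ι ι ℝ)ᵀ = 1 :=
    mul_eq_one_comm.1 h1
  have h3 : X = (hH.eigenvectorUnitary : Matrix ι ι ℝ) * diagonal hH.eigenvalues *
      (hH.eigenvectorUnitary : Matrix ι ι ℝ)ᵀ := by
    have := hH.spectral_theorem
    rw [Unitary.conjStarAlgAut_apply, star_eq_conjTranspose, conjTranspose_eq_transpose_of_trivial] at this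
    simpa [Function.comp_def] using this
  refine ⟨hH.eigenvectorUnitary, hH.eigenvalues, h1, h2, ?_⟩
  generalize (hH.eigenvectorUnitary : Matrix ι ι ℝ) = U at *
  generalize hH.eigenvalues = l at *
  intro s
  induction s with
  | zero => simp [h2]
  | succ s ih =>
    have : diagonal (fun i => l i ^ (s+1)) = diagonal (fun i => l i ^ s) * diagonal l := by
      rw [diagonal_mul_diagonal]; simp [pow_succ]
    rw [pow_succ, ih, this]
    nth_rw 1 [h3]
    calc _ = U * diagonal (fun i => l i ^ s) * (Uᵀ * U) * diagonal l * Uᵀ := by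
          simp only [Matrix.mul_assoc]
      _ = _ := by rw [h1]; simp only [Matrix.mul_assoc, Matrix.mul_one, Matrix.one_mul]

theorem kk_scalar (a b : ℝ) (s t r : ℕ) (h : s + t = 2 * r) :
    a ^ s * b ^ t ≤ a ^ (2 * r) + b ^ (2 * r) := by
  have h1 : a ^ s * b ^ t ≤ |a| ^ s * |b| ^ t := by
    rw [← abs_pow, ← abs_pow, ← abs_mul]; exact le_abs_self _
  have ha : a ^ (2 * r) = |a| ^ (2 * r) := by rw [pow_mul, pow_mul, sq_abs]
  have hb : b ^ (2 * r) = |b| ^ (2 * r) := by rw [pow_mul, pow_mul, sq_abs]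
  rw [ha, hb]
  refine h1.trans ?_
  have pa := abs_nonneg a
  have pb := abs_nonneg b
  rcases le_total |a| |b| with hab | hab
  · calc |a| ^ s * |b| ^ t ≤ |b| ^ s * |b| ^ t := by gcongr
      _ = |b| ^ (2 * r) := by rw [← pow_add, h]
      _ ≤ _ := by have := pow_nonneg pa (2 * r); linarith
  · calc |a| ^ s * |b| ^ t ≤ |a| ^ s * |a| ^ t := by gcongr
      _ = |a| ^ (2 * r) := by rw [← pow_add, h]
      _ ≤ _ := by have := pow_nonneg pb (2 * r); linarith

theorem kk_trace_am (H W Y : Matrix ι ι ℝ) (hH : Hᵀ = H) (hW : Wᵀ = W) (hY : Yᵀ = Y)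
    (s t r : ℕ) (h : s + t = 2 * r) :
    trace (H * W ^ s * H * Y ^ t) ≤ trace (H * H * W ^ (2 * r)) + trace (H * H * Y ^ (2 * r)) := by
  obtain ⟨U, l, hU1, hU2, hU⟩ := kk_spec W hW
  obtain ⟨V, m, hV1, hV2, hV⟩ := kk_spec Y hY
  set B := Vᵀ * H * U with hB
  have hBt : Bᵀ = Uᵀ * H * V := by
    rw [hB]; simp [transpose_mul, hH, Matrix.mul_assoc]
  have e1 : trace (H * W ^ s * H * Y ^ t) = ∑ v, ∑ u, B v u ^ 2 * (l u ^ s * m v ^ t) := by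
    rw [hU, hV]
    have : H * (U * diagonal (fun i => l i ^ s) * Uᵀ) * H * (V * diagonal (fun i => m i ^ t) * Vᵀ)
        = (H * U * diagonal (fun i => l i ^ s) * (Uᵀ * H * V) * diagonal (fun i => m i ^ t)) * Vᵀ := by
      simp only [Matrix.mul_assoc]
    rw [this, trace_mul_comm, ← hBt]
    have : Vᵀ * (H * U * diagonal (fun i => l i ^ s) * Bᵀ * diagonal (fun i => m i ^ t))
        = (B * diagonal (fun i => l i ^ s)) * Bᵀ * diagonal (fun i => m i ^ t) := by
      rw [hB]; simp only [Matrix.mul_assoc]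
    rw [this, trace]
    refine Finset.sum_congr rfl fun v _ => ?_
    rw [diag_apply, mul_diagonal, mul_apply, Finset.sum_mul]
    refine Finset.sum_congr rfl fun u _ => ?_
    rw [mul_diagonal, transpose_apply]; ring
  have e2 : trace (H * H * W ^ (2 * r)) = ∑ v, ∑ u, B v u ^ 2 * l u ^ (2 * r) := by
    rw [hU]
    have : H * H * (U * diagonal (fun i => l i ^ (2 * r)) * Uᵀ)
        = (H * (V * Vᵀ) * H * U * diagonal (fun i => l i ^ (2 * r))) * Uᵀ := by
      rw [hV2]; simp only [Matrix.mul_assoc, Matrix.one_mul]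
    rw [this, trace_mul_comm]
    have : Uᵀ * (H * (V * Vᵀ) * H * U * diagonal (fun i => l i ^ (2 * r)))
        = Bᵀ * B * diagonal (fun i => l i ^ (2 * r)) := by
      rw [hBt, hB]; simp only [Matrix.mul_assoc]
    rw [this, trace, Finset.sum_comm]
    refine Finset.sum_congr rfl fun v _ => ?_
    rw [diag_apply, mul_diagonal, mul_apply, Finset.sum_mul]
    refine Finset.sum_congr rfl fun u _ => ?_
    rw [transpose_apply]; ring
  have e3 : trace (H * H * Y ^ (2 * r)) = ∑ v, ∑ u, B v u ^ 2 * m v ^ (2 * r) := by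
    rw [hV]
    have : H * H * (V * diagonal (fun i => m i ^ (2 * r)) * Vᵀ)
        = (H * (U * Uᵀ) * H * V * diagonal (fun i => m i ^ (2 * r))) * Vᵀ := by
      rw [hU2]; simp only [Matrix.mul_assoc, Matrix.one_mul]
    rw [this, trace_mul_comm]
    have : Vᵀ * (H * (U * Uᵀ) * H * V * diagonal (fun i => m i ^ (2 * r)))
        = B * Bᵀ * diagonal (fun i => m i ^ (2 * r)) := by
      rw [hBt, hB]; simp only [Matrix.mul_assoc]
    rw [this, trace]
    refine Finset.sum_congr rfl fun v _ => ?_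
    rw [diag_apply, mul_diagonal, mul_apply, Finset.sum_mul]
    refine Finset.sum_congr rfl fun u _ => ?_
    rw [transpose_apply]; ring
  rw [e1, e2, e3, ← Finset.sum_add_distrib]
  refine Finset.sum_le_sum fun v _ => ?_
  rw [← Finset.sum_add_distrib]
  refine Finset.sum_le_sum fun u _ => ?_
  rw [← mul_add]
  exact mul_le_mul_of_nonneg_left (kk_scalar _ _ _ _ _ h) (sq_nonneg _)

theorem kk_telescope {R : Type*} [Ring R] (W Y : R) (N : ℕ) :
    W ^ N - Y ^ N = ∑ s ∈ Finset.range N, W ^ s * (W - Y) * Y ^ (N - 1 - s) := by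
  induction N with
  | zero => simp
  | succ N ih =>
    rw [Finset.sum_range_succ]
    have : ∑ s ∈ Finset.range N, W ^ s * (W - Y) * Y ^ (N + 1 - 1 - s)
        = (∑ s ∈ Finset.range N, W ^ s * (W - Y) * Y ^ (N - 1 - s)) * Y := by
      rw [Finset.sum_mul]
      refine Finset.sum_congr rfl fun s hs => ?_
      have hs := Finset.mem_range.1 hs
      rw [mul_assoc (_ * _), ← pow_succ]
      congr 2; omega
    rw [this, ← ih]
    simp only [Nat.add_sub_cancel, Nat.sub_self, pow_zero, mul_one, pow_succ]
    noncomm_ring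

/-- variance control -/
theorem kk_var (H : κ → Matrix ι ι ℝ) (hH : ∀ K, (H K)ᵀ = H K) (σ : ℝ)
    (hσ : ∀ v : ι → ℝ, ∑ K, ∑ i, (∑ j, H K i j * v j) ^ 2 ≤ σ * ∑ j, v j ^ 2)
    (X : Matrix ι ι ℝ) (hX : Xᵀ = X) (r : ℕ) :
    ∑ K, trace (H K * H K * X ^ (2 * r)) ≤ σ * trace (X ^ (2 * r)) := by
  set Z := X ^ r with hZ
  have hZt : Zᵀ = Z := by rw [hZ, transpose_pow, hX]
  have hZZ : X ^ (2 * r) = Z * Z := by rw [hZ, ← pow_add, two_mul]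
  have e0 : trace (X ^ (2 * r)) = ∑ c, ∑ j, Z j c ^ 2 := by
    rw [hZZ, trace]
    refine Finset.sum_congr rfl fun c _ => ?_
    rw [diag_apply, mul_apply]
    refine Finset.sum_congr rfl fun j _ => ?_
    have : Z c j = Z j c := by conv_lhs => rw [← hZt, transpose_apply]
    rw [this]; ring
  have e1 : ∀ K, trace (H K * H K * X ^ (2 * r)) = ∑ c, ∑ i, (∑ j, H K i j * Z j c) ^ 2 := by
    intro K
    have : H K * H K * X ^ (2 * r) = (H K * (H K * Z)) * Z := by
      rw [hZZ]; simp only [Matrix.mul_assoc]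
    rw [this, trace_mul_comm]
    have : Z * (H K * (H K * Z)) = (H K * Z)ᵀ * (H K * Z) := by
      rw [transpose_mul, hH, hZt, Matrix.mul_assoc]
    rw [this, trace]
    refine Finset.sum_congr rfl fun c _ => ?_
    rw [diag_apply, mul_apply]
    refine Finset.sum_congr rfl fun j _ => ?_
    rw [transpose_apply, mul_apply, sq]
  simp_rw [e1, e0]
  rw [Finset.sum_comm, Finset.mul_sum]
  exact Finset.sum_le_sum fun c _ => hσ _

/-- sign -/
def kkSgn (b : Bool) : ℝ := if b then 1 else -1

def kkX (H : κ → Matrix ι ι ℝ) (A : κ → Bool) : Matrix ι ι ℝ := ∑ K, kkSgn (A K) • H K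

theorem kkX_symm (H : κ → Matrix ι ι ℝ) (hH : ∀ K, (H K)ᵀ = H K) (A : κ → Bool) :
    (kkX H A)ᵀ = kkX H A := by
  simp [kkX, transpose_sum, hH]

def kkFlip (K : κ) (A : κ → Bool) : κ → Bool := Function.update A K (!(A K))

theorem kkFlip_inv (K : κ) : Function.Involutive (kkFlip K) := by
  intro A
  funext K'
  by_cases h : K' = K
  · subst h; simp [kkFlip]
  · simp [kkFlip, h]

theorem kkX_flip (H : κ → Matrix ι ι ℝ) (A : κ → Bool) (K : κ) :
    kkX H A - kkX H (kkFlip K A) = (2 * kkSgn (A K)) • H K := by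
  rw [kkX, kkX, ← Finset.sum_sub_distrib]
  rw [Finset.sum_eq_single K]
  · rw [← sub_smul]; congr 1
    cases h : A K <;> simp [kkFlip, kkSgn, h] <;> norm_num
  · intro b _ hb; simp [kkFlip, hb]
  · simp

theorem kkSgn_sq (b : Bool) : kkSgn b * kkSgn b = 1 := by cases b <;> simp [kkSgn]
theorem kkSgn_not (b : Bool) : kkSgn (!b) = - kkSgn b := by cases b <;> simp [kkSgn]

theorem kk_step (H : κ → Matrix ι ι ℝ) (hH : ∀ K, (H K)ᵀ = H K) (σ : ℝ)
    (hσ : ∀ v : ι → ℝ, ∑ K, ∑ i, (∑ j, H K i j * v j) ^ 2 ≤ σ * ∑ j, v j ^ 2) (r : ℕ) :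
    ∑ A : κ → Bool, trace (kkX H A ^ (2 * (r + 1))) ≤
      (2 * (2 * r + 1)) * σ * ∑ A : κ → Bool, trace (kkX H A ^ (2 * r)) := by
  have key : ∀ K, ∑ A : κ → Bool, kkSgn (A K) * trace (H K * kkX H A ^ (2 * r + 1)) ≤
      (2 * (2 * r + 1)) * ∑ A : κ → Bool, trace (H K * H K * kkX H A ^ (2 * r)) := by
    intro K
    let e : (κ → Bool) ≃ (κ → Bool) := (kkFlip_inv K).toPerm
    have he : ∀ A, e A = kkFlip K A := fun A => rfl
    have h1 : ∑ A : κ → Bool, kkSgn (A K) * trace (H K * kkX H A ^ (2 * r + 1))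
        = ∑ A : κ → Bool, - (kkSgn (A K) * trace (H K * kkX H (kkFlip K A) ^ (2 * r + 1))) := by
      rw [← Equiv.sum_comp e]
      refine Finset.sum_congr rfl fun A _ => ?_
      rw [he]
      have : (kkFlip K A) K = !(A K) := by simp [kkFlip]
      rw [this, kkSgn_not]; ring
    have h2 : ∑ A : κ → Bool, kkSgn (A K) * trace (H K * kkX H A ^ (2 * r + 1))
        = ∑ A : κ → Bool, (1/2) * (kkSgn (A K) * trace (H K * (kkX H A ^ (2 * r + 1) - kkX H (kkFlip K A) ^ (2 * r + 1)))) := by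
      have : ∀ A : κ → Bool, (1/2) * (kkSgn (A K) * trace (H K * (kkX H A ^ (2 * r + 1) - kkX H (kkFlip K A) ^ (2 * r + 1))))
        = (1/2) * (kkSgn (A K) * trace (H K * kkX H A ^ (2 * r + 1))) + (1/2) * (- (kkSgn (A K) * trace (H K * kkX H (kkFlip K A) ^ (2 * r + 1)))) := by
        intro A; rw [Matrix.mul_sub, trace_sub]; ring
      simp_rw [this]
      rw [Finset.sum_add_distrib, ← Finset.mul_sum, ← Finset.mul_sum, ← h1]; ring
    rw [h2]
    have h3 : ∀ A : κ → Bool, (1/2) * (kkSgn (A K) * trace (H K * (kkX H A ^ (2 * r + 1) - kkX H (kkFlip K A) ^ (2 * r + 1))))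
        ≤ (2 * r + 1) * (trace (H K * H K * kkX H A ^ (2 * r)) + trace (H K * H K * kkX H (kkFlip K A) ^ (2 * r))) := by
      intro A
      rw [kk_telescope, Finset.mul_sum, trace_sum, Finset.mul_sum, Finset.mul_sum]
      have : ∀ s ∈ Finset.range (2 * r + 1), (1/2) * (kkSgn (A K) * trace (H K * (kkX H A ^ s * (kkX H A - kkX H (kkFlip K A)) * kkX H (kkFlip K A) ^ (2 * r + 1 - 1 - s))))
          ≤ trace (H K * H K * kkX H A ^ (2 * r)) + trace (H K * H K * kkX H (kkFlip K A) ^ (2 * r)) := by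
        intro s hs
        have hs := Finset.mem_range.1 hs
        rw [kkX_flip]
        refine le_trans (le_of_eq ?_) (kk_trace_am (H K) (kkX H A) (kkX H (kkFlip K A)) (hH K) (kkX_symm H hH _) (kkX_symm H hH _) s (2 * r + 1 - 1 - s) r (by omega))
        rw [Matrix.mul_smul, Matrix.smul_mul, Matrix.mul_smul, trace_smul, smul_eq_mul]
        have h5 := kkSgn_sq (A K)
        simp only [Matrix.mul_assoc]
        linear_combination (trace (H K * (kkX H A ^ s * (H K * kkX H (kkFlip K A) ^ (2 * r + 1 - 1 - s))))) * h5
      refine (Finset.sum_le_sum this).trans (le_of_eq ?_)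
      rw [Finset.sum_const, Finset.card_range, nsmul_eq_mul]; push_cast; ring
    refine (Finset.sum_le_sum fun A _ => h3 A).trans (le_of_eq ?_)
    rw [← Finset.mul_sum, Finset.sum_add_distrib]
    have : ∑ A : κ → Bool, trace (H K * H K * kkX H (kkFlip K A) ^ (2 * r)) = ∑ A : κ → Bool, trace (H K * H K * kkX H A ^ (2 * r)) :=
      Equiv.sum_comp e (fun A => trace (H K * H K * kkX H A ^ (2 * r)))
    rw [this]; ring
  have h0 : ∀ A : κ → Bool, trace (kkX H A ^ (2 * (r + 1))) = ∑ K, kkSgn (A K) * trace (H K * kkX H A ^ (2 * r + 1)) := by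
    intro A
    have : kkX H A ^ (2 * (r + 1)) = (∑ K, kkSgn (A K) • H K) * kkX H A ^ (2 * r + 1) := by
      rw [← kkX, ← pow_succ']; rfl
    rw [this, Finset.sum_mul, trace_sum]
    refine Finset.sum_congr rfl fun K _ => ?_
    rw [Matrix.smul_mul, trace_smul, smul_eq_mul]
  simp_rw [h0]
  rw [Finset.sum_comm]
  refine (Finset.sum_le_sum fun K _ => key K).trans ?_
  rw [← Finset.mul_sum, Finset.sum_comm, mul_assoc (2 * (2 * (r:ℝ) + 1))]
  refine mul_le_mul_of_nonneg_left ?_ (show (0:ℝ) ≤ 2 * (2 * r + 1) by positivity)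
  rw [Finset.mul_sum]
  exact Finset.sum_le_sum fun A _ => kk_var H hH σ hσ _ (kkX_symm H hH A) r

theorem kk_moment (H : κ → Matrix ι ι ℝ) (hH : ∀ K, (H K)ᵀ = H K) (σ : ℝ) (hσ0 : 0 ≤ σ)
    (hσ : ∀ v : ι → ℝ, ∑ K, ∑ i, (∑ j, H K i j * v j) ^ 2 ≤ σ * ∑ j, v j ^ 2) (m : ℕ) :
    ∀ r, r ≤ m → ∑ A : κ → Bool, trace (kkX H A ^ (2 * r)) ≤
      (4 * m * σ) ^ r * (Fintype.card (κ → Bool) * Fintype.card ι) := by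
  intro r
  induction r with
  | zero => intro _; simp
  | succ r ih =>
    intro hr
    have hr' : ((r : ℝ) + 1) ≤ m := by exact_mod_cast hr
    refine (kk_step H hH σ hσ r).trans ?_
    have h1 : (2 * (2 * (r:ℝ) + 1)) * σ ≤ 4 * m * σ := by
      apply mul_le_mul_of_nonneg_right _ hσ0; linarith
    calc _ ≤ (2 * (2 * (r:ℝ) + 1)) * σ * ((4 * m * σ) ^ r * (Fintype.card (κ → Bool) * Fintype.card ι)) := by
          apply mul_le_mul_of_nonneg_left (ih (by omega)); positivity
      _ ≤ (4 * m * σ) * ((4 * m * σ) ^ r * (Fintype.card (κ → Bool) * Fintype.card ι)) := by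
          apply mul_le_mul_of_nonneg_right h1; positivity
      _ = _ := by ring

theorem kk_trace_nonneg (X : Matrix ι ι ℝ) (hX : Xᵀ = X) (r : ℕ) : 0 ≤ trace (X ^ (2 * r)) := by
  obtain ⟨U, l, h1, h2, h⟩ := kk_spec X hX
  rw [h, trace_mul_comm, ← Matrix.mul_assoc, h1, Matrix.one_mul, trace_diagonal]
  exact Finset.sum_nonneg fun i _ => by rw [pow_mul]; positivity

/-- certificate: quadratic-form bound from the trace, phrased with sums of squares. -/
theorem kk_cert (X : Matrix ι ι ℝ) (hX : Xᵀ = X) (m : ℕ) (hm : m ≠ 0) (t : ℝ) (ht : 0 ≤ t)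
    (h : trace (X ^ (2 * m)) ≤ t ^ (2 * m)) :
    ∃ (U : Matrix ι ι ℝ) (l : ι → ℝ), (∀ u, l u ≤ t) ∧ U * Uᵀ = 1 ∧
      X = U * diagonal l * Uᵀ := by
  obtain ⟨U, l, h1, h2, hs⟩ := kk_spec X hX
  refine ⟨U, l, ?_, h2, by simpa using hs 1⟩
  intro u
  rw [hs, trace_mul_comm, ← Matrix.mul_assoc, h1, Matrix.one_mul, trace_diagonal] at h
  have h3 : l u ^ (2 * m) ≤ t ^ (2 * m) :=
    (Finset.single_le_sum (f := fun i => l i ^ (2 * m)) (fun i _ => by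
      simp only [pow_mul]; positivity) (Finset.mem_univ u)).trans h
  have h4 := abs_le_of_sq_le_sq' (a := l u) (b := t) ?_ ht
  · exact h4.2
  rw [pow_mul, pow_mul] at h3
  exact le_of_pow_le_pow_left₀ hm (by positivity) h3

theorem kk_cs (α : Type*) [Fintype α] {h : ℕ} (F : (Fin (h + 1) → α) → ℝ) :
    ∑ x, F x = ∑ a, ∑ y, F (Fin.cons a y) := by
  rw [← (Fin.consEquiv (fun _ => α)).sum_comp, Fintype.sum_prod_type]
  rfl

theorem kk_tensor {P T : Type*} [Fintype P] [Fintype T] (g : P → T → T → ℝ) (τ : ℝ) (hτ : 0 ≤ τ)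
    (hg : ∀ w : T → ℝ, ∑ p, ∑ I, (∑ J, g p I J * w J) ^ 2 ≤ τ * ∑ J, w J ^ 2) (h : ℕ) :
    ∀ v : (Fin h → T) → ℝ, ∑ p : Fin h → P, ∑ I : Fin h → T,
      (∑ J : Fin h → T, (∏ j, g (p j) (I j) (J j)) * v J) ^ 2 ≤ τ ^ h * ∑ J, v J ^ 2 := by
  induction h with
  | zero => intro v; simp
  | succ h ih =>
    intro v
    rw [kk_cs P]
    simp_rw [kk_cs T, Fin.prod_univ_succ, Fin.cons_zero, Fin.cons_succ]
    have h1 : ∀ (p0 : P) (p' : Fin h → P) (I0 : T) (I' : Fin h → T),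
        ∑ a, ∑ y : Fin h → T, g p0 I0 a * (∏ i, g (p' i) (I' i) (y i)) * v (Fin.cons a y)
        = ∑ a, g p0 I0 a * ∑ y : Fin h → T, (∏ i, g (p' i) (I' i) (y i)) * v (Fin.cons a y) := by
      intros
      refine Finset.sum_congr rfl fun a _ => ?_
      rw [Finset.mul_sum]
      refine Finset.sum_congr rfl fun a _ => ?_
      ring
    simp_rw [h1]
    rw [Finset.sum_comm]
    have h2 : ∀ p' : Fin h → P, ∑ p0, ∑ I0, ∑ I' : Fin h → T,
        (∑ a, g p0 I0 a * ∑ y : Fin h → T, (∏ i, g (p' i) (I' i) (y i)) * v (Fin.cons a y)) ^ 2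
        ≤ τ * ∑ a, ∑ I' : Fin h → T, (∑ y : Fin h → T, (∏ i, g (p' i) (I' i) (y i)) * v (Fin.cons a y)) ^ 2 := by
      intro p'
      have : ∀ p0, ∑ I0, ∑ I' : Fin h → T,
        (∑ a, g p0 I0 a * ∑ y : Fin h → T, (∏ i, g (p' i) (I' i) (y i)) * v (Fin.cons a y)) ^ 2
        = ∑ I' : Fin h → T, ∑ I0, 
        (∑ a, g p0 I0 a * ∑ y : Fin h → T, (∏ i, g (p' i) (I' i) (y i)) * v (Fin.cons a y)) ^ 2 :=
        fun p0 => Finset.sum_comm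
      simp_rw [this]
      rw [Finset.sum_comm]
      rw [Finset.sum_comm (s := (Finset.univ : Finset T)), Finset.mul_sum]
      exact Finset.sum_le_sum fun I' _ => hg _
    refine (Finset.sum_le_sum fun p' _ => h2 p').trans ?_
    rw [← Finset.mul_sum, pow_succ', mul_assoc]
    refine mul_le_mul_of_nonneg_left ?_ hτ
    rw [Finset.sum_comm, Finset.mul_sum]
    exact Finset.sum_le_sum fun a _ => ih _

def kkm {n L : ℕ} (s t : Fin L) (p : Fin n × Fin n) (i j : Fin n) : ℝ :=
  if t = s then (if i = p.1 ∧ j = p.2 then 1 else 0) else if i = j then 1 else 0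

noncomputable def kkg {n L : ℕ} (p : Fin n × Fin n) (I J : Fin L → Fin n) : ℝ :=
  (L : ℝ)⁻¹ * ∑ s, ∏ t, kkm s t p (I t) (J t)

theorem kkg_swap {n L : ℕ} (p : Fin n × Fin n) (I J : Fin L → Fin n) :
    kkg p.swap I J = kkg p J I := by
  unfold kkg kkm
  simp only [Prod.fst_swap, Prod.snd_swap, and_comm, eq_comm]

theorem kkm_prod {n L : ℕ} (s : Fin L) (p : Fin n × Fin n) (I J : Fin L → Fin n) :
    ∏ t, kkm s t p (I t) (J t) = if J = Function.update I s p.2 then (if I s = p.1 then 1 else 0) else 0 := by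
  by_cases h : J = Function.update I s p.2
  · rw [if_pos h, Finset.prod_eq_single s]
    · simp [kkm, h]
    · intro t _ ht
      simp [kkm, ht, h]
    · simp
  · rw [if_neg h]
    obtain ⟨t, ht⟩ := Function.ne_iff.1 h
    refine Finset.prod_eq_zero (Finset.mem_univ t) ?_
    by_cases hts : t = s
    · subst hts; simp at ht; simp [kkm, ht]
    · simp [hts] at ht; simp [kkm, hts, Ne.symm ht]

theorem kkg_apply {n L : ℕ} (p : Fin n × Fin n) (I : Fin L → Fin n) (w : (Fin L → Fin n) → ℝ) :
    ∑ J, kkg p I J * w J = (L : ℝ)⁻¹ * ∑ s, (if I s = p.1 then 1 else 0) * w (Function.update I s p.2) := by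
  unfold kkg
  simp_rw [mul_assoc]
  rw [← Finset.mul_sum]
  congr 1
  simp_rw [Finset.sum_mul]
  rw [Finset.sum_comm]
  refine Finset.sum_congr rfl fun s _ => ?_
  simp_rw [kkm_prod]
  rw [Finset.sum_eq_single (Function.update I s p.2)]
  · simp
  · intro b _ hb; simp [hb]
  · simp

def kkc {n L : ℕ} (I : Fin L → Fin n) (s : Fin L) : ℝ := ∑ t, if I t = I s then 1 else 0

theorem kkc_sum {n L : ℕ} (J : Fin L → Fin n) (s : Fin L) :
    ∑ a, kkc (Function.update J s a) s ≤ (n : ℝ) + L := by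
  unfold kkc
  rw [Finset.sum_comm]
  have : ∀ t, ∑ a : Fin n, (if Function.update J s a t = Function.update J s a s then (1:ℝ) else 0)
      ≤ (if t = s then (n:ℝ) else 0) + 1 := by
    intro t
    by_cases h : t = s
    · subst h; simp
    · simp [h]
  refine (Finset.sum_le_sum fun t _ => this t).trans ?_
  rw [Finset.sum_add_distrib]; simp

theorem kk_swapsum {n L : ℕ} (s : Fin L) (F G : (Fin L → Fin n) → ℝ) :
    ∑ b, ∑ I, F I * G (Function.update I s b) = ∑ a, ∑ J, F (Function.update J s a) * G J := by
  rw [← Fintype.sum_prod_type', ← Fintype.sum_prod_type']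
  let e : (Fin n × (Fin L → Fin n)) → (Fin n × (Fin L → Fin n)) :=
    fun x => (x.2 s, Function.update x.2 s x.1)
  have he : Function.Involutive e := by
    intro x; ext <;> simp [e]
  rw [← Equiv.sum_comp he.toPerm]
  refine Finset.sum_congr rfl fun x _ => ?_
  simp [e]

theorem kkg_norm {n L : ℕ} (hL : 0 < L) (w : (Fin L → Fin n) → ℝ) :
    ∑ p : Fin n × Fin n, ∑ I, (∑ J, kkg p I J * w J) ^ 2 ≤ ((n : ℝ) / L + 1) * ∑ J, w J ^ 2 := by
  simp_rw [kkg_apply, mul_pow]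
  have hL' : (0:ℝ) < L := by exact_mod_cast hL
  have h1 : ∀ (I : Fin L → Fin n) (b : Fin n),
      ∑ a, (∑ s, (if I s = a then (1:ℝ) else 0) * w (Function.update I s b)) ^ 2
        ≤ ∑ s, kkc I s * w (Function.update I s b) ^ 2 := by
    intro I b
    have : ∀ a, (∑ s, (if I s = a then (1:ℝ) else 0) * w (Function.update I s b)) ^ 2
        ≤ ∑ s, (if I s = a then kkc I s * w (Function.update I s b) ^ 2 else 0) := by
      intro a
      have e1 : ∑ s, (if I s = a then (1:ℝ) else 0) * w (Function.update I s b)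
        = ∑ s, (if I s = a then (1:ℝ) else 0) * ((if I s = a then (1:ℝ) else 0) * w (Function.update I s b)) := by
        refine Finset.sum_congr rfl fun s _ => ?_
        split_ifs <;> simp
      rw [e1]
      refine (Finset.sum_mul_sq_le_sq_mul_sq _ _ _).trans (le_of_eq ?_)
      rw [Finset.mul_sum]
      refine Finset.sum_congr rfl fun s _ => ?_
      split_ifs with h
      · simp [kkc, h]
      · simp
    refine (Finset.sum_le_sum fun a _ => this a).trans (le_of_eq ?_)
    rw [Finset.sum_comm]
    simp
  rw [Fintype.sum_prod_type, Finset.sum_comm]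
  have h2 : ∀ b : Fin n, ∑ a : Fin n, ∑ I : Fin L → Fin n, ((L:ℝ)⁻¹) ^ 2 * (∑ s, (if I s = a then (1:ℝ) else 0) * w (Function.update I s b)) ^ 2
      ≤ ((L:ℝ)⁻¹) ^ 2 * ∑ s, ∑ I : Fin L → Fin n, kkc I s * w (Function.update I s b) ^ 2 := by
    intro b
    rw [Finset.sum_comm, Finset.sum_comm (s := (Finset.univ : Finset (Fin L))), Finset.mul_sum]
    refine Finset.sum_le_sum fun I _ => ?_
    rw [← Finset.mul_sum]
    exact mul_le_mul_of_nonneg_left (h1 I b) (by positivity)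
  refine (Finset.sum_le_sum fun b _ => h2 b).trans ?_
  rw [← Finset.mul_sum, Finset.sum_comm]
  have h3 : ∀ s : Fin L, ∑ b : Fin n, ∑ I : Fin L → Fin n, kkc I s * w (Function.update I s b) ^ 2
      ≤ ((n:ℝ) + L) * ∑ J, w J ^ 2 := by
    intro s
    rw [kk_swapsum s (fun I => kkc I s) (fun J => w J ^ 2), Finset.sum_comm, Finset.mul_sum]
    refine Finset.sum_le_sum fun J _ => ?_
    rw [← Finset.sum_mul]
    exact mul_le_mul_of_nonneg_right (kkc_sum J s) (sq_nonneg _)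
  calc _ ≤ ((L:ℝ)⁻¹) ^ 2 * ∑ s : Fin L, ((n:ℝ) + L) * ∑ J, w J ^ 2 := by
        exact mul_le_mul_of_nonneg_left (Finset.sum_le_sum fun s _ => h3 s) (by positivity)
    _ = _ := by
        rw [Finset.sum_const, Finset.card_univ, Fintype.card_fin, nsmul_eq_mul]
        field_simp

theorem kkg_norm' {n L : ℕ} (hL : 0 < L) (w : (Fin L → Fin n) → ℝ) :
    ∑ p : Fin n × Fin n, ∑ I, (∑ J, kkg p J I * w J) ^ 2 ≤ ((n : ℝ) / L + 1) * ∑ J, w J ^ 2 := by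
  refine le_trans (le_of_eq ?_) (kkg_norm hL w)
  rw [← (Equiv.prodComm (Fin n) (Fin n)).sum_comp]
  refine Finset.sum_congr rfl fun p _ => ?_
  simp only [Equiv.prodComm_apply, kkg_swap]

/-- the symmetrised tensor-product operators -/
noncomputable def kkH {n h L : ℕ} (p : Fin h → Fin n × Fin n) :
    Matrix (Fin h → Fin L → Fin n) (Fin h → Fin L → Fin n) ℝ :=
  Matrix.of fun I J => (1 / 2) * (∏ j, kkg (p j) (I j) (J j) + ∏ j, kkg (p j) (J j) (I j))

theorem kkH_symm {n h L : ℕ} (p : Fin h → Fin n × Fin n) : (kkH (L := L) p)ᵀ = kkH p := by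
  ext I J
  simp [kkH, add_comm]

theorem kkH_norm {n h L : ℕ} (hL : 0 < L) (v : (Fin h → Fin L → Fin n) → ℝ) :
    ∑ p : Fin h → Fin n × Fin n, ∑ I, (∑ J, kkH p I J * v J) ^ 2 ≤
      ((n : ℝ) / L + 1) ^ h * ∑ J, v J ^ 2 := by
  have a := kk_tensor (fun (p : Fin n × Fin n) (I J : Fin L → Fin n) => kkg p I J) ((n : ℝ) / L + 1)
    (by positivity) (kkg_norm hL) h v
  have b := kk_tensor (fun (p : Fin n × Fin n) (I J : Fin L → Fin n) => kkg p J I) ((n : ℝ) / L + 1)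
    (by positivity) (kkg_norm' hL) h v
  have : ∀ (p : Fin h → Fin n × Fin n) (I : Fin h → Fin L → Fin n), (∑ J, kkH p I J * v J) ^ 2
      ≤ (1/2) * (∑ J, (∏ j, kkg (p j) (I j) (J j)) * v J) ^ 2 + (1/2) * (∑ J, (∏ j, kkg (p j) (J j) (I j)) * v J) ^ 2 := by
    intro p I
    have e : ∑ J, kkH p I J * v J = (1/2) * (∑ J, (∏ j, kkg (p j) (I j) (J j)) * v J + ∑ J, (∏ j, kkg (p j) (J j) (I j)) * v J) := by
      rw [← Finset.sum_add_distrib, Finset.mul_sum]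
      refine Finset.sum_congr rfl fun J _ => ?_
      simp only [kkH, Matrix.of_apply]; ring
    rw [e]
    nlinarith [sq_nonneg ((∑ J, (∏ j, kkg (p j) (I j) (J j)) * v J) - ∑ J, (∏ j, kkg (p j) (J j) (I j)) * v J)]
  refine (Finset.sum_le_sum fun p _ => Finset.sum_le_sum fun I _ => this p I).trans ?_
  simp_rw [Finset.sum_add_distrib, ← Finset.mul_sum]
  linarith

/-! polynomial identities -/
theorem kk_prodsum2 {R T : Type*} [CommSemiring R] [Fintype T] {h : ℕ} (F : Fin h → T → T → R) :
    ∑ I : Fin h → T, ∑ J : Fin h → T, ∏ j, F j (I j) (J j) = ∏ j, ∑ a, ∑ b, F j a b := by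
  classical
  simp_rw [← Fintype.sum_prod_type']
  rw [Finset.prod_univ_sum, Fintype.piFinset_univ,
    ← (Equiv.arrowProdEquivProdArrow (Fin h) (fun _ => T) (fun _ => T)).sum_comp]
  rfl

theorem kk_prodsum1 {R T : Type*} [CommSemiring R] [Fintype T] {h : ℕ} (F : Fin h → T → R) :
    ∑ I : Fin h → T, ∏ j, F j (I j) = ∏ j, ∑ a, F j a := by
  classical
  rw [Finset.prod_univ_sum, Fintype.piFinset_univ]

open MvPolynomial in
noncomputable def kkmon {n h L : ℕ} (I : Fin h → Fin L → Fin n) : MvPolynomial (Fin n) ℝ := ∏ j, ∏ t, X (I j t)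

open MvPolynomial in
noncomputable def kkS (n : ℕ) : MvPolynomial (Fin n) ℝ := ∑ i, X i ^ 2

open MvPolynomial in
theorem kkmon_sq {n h L : ℕ} :
    ∑ I : Fin h → Fin L → Fin n, kkmon I * kkmon I = kkS n ^ (h * L) := by
  unfold kkmon
  simp_rw [← Finset.prod_mul_distrib]
  rw [kk_prodsum1 (fun _ (a : Fin L → Fin n) => ∏ t, ((X (a t) : MvPolynomial (Fin n) ℝ) * X (a t)))]
  simp_rw [kk_prodsum1 (fun _ (a : Fin n) => ((X a : MvPolynomial (Fin n) ℝ) * X a))]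
  simp [kkS, ← pow_mul, mul_comm, sq]

open MvPolynomial in
theorem kkm_poly {n L : ℕ} (s t : Fin L) (p : Fin n × Fin n) :
    ∑ i, ∑ j, (C (kkm s t p i j) * (X i * X j) : MvPolynomial (Fin n) ℝ) =
      if t = s then X p.1 * X p.2 else kkS n := by
  by_cases h : t = s
  · simp only [kkm, h, if_true]
    rw [Finset.sum_eq_single p.1, Finset.sum_eq_single p.2]
    · simp
    · intro b _ hb; simp [hb]
    · simp
    · intro b _ hb; simp [hb]
    · simp
  · simp only [kkm, h, if_false, kkS]
    refine Finset.sum_congr rfl fun i _ => ?_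
    rw [Finset.sum_eq_single i]
    · simp [sq]
    · intro b _ hb; simp [Ne.symm hb]
    · simp

open MvPolynomial in
theorem kkg_poly {n L : ℕ} (hL : 0 < L) (p : Fin n × Fin n) :
    ∑ I : Fin L → Fin n, ∑ J : Fin L → Fin n, (C (kkg p I J) * ((∏ t, X (I t)) * (∏ t, X (J t))) : MvPolynomial (Fin n) ℝ) =
      X p.1 * X p.2 * kkS n ^ (L - 1) := by
  have h1 : ∀ I J : Fin L → Fin n, (C (kkg p I J) * ((∏ t, X (I t)) * (∏ t, X (J t))) : MvPolynomial (Fin n) ℝ)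
      = ∑ s, C (L : ℝ)⁻¹ * ∏ t, (C (kkm s t p (I t) (J t)) * (X (I t) * X (J t))) := by
    intro I J
    simp only [kkg, map_mul, map_sum, map_prod, Finset.prod_mul_distrib, Finset.mul_sum, Finset.sum_mul, mul_assoc]
  have h2 : ∑ I : Fin L → Fin n, ∑ J : Fin L → Fin n, (C (kkg p I J) * ((∏ t, X (I t)) * (∏ t, X (J t))) : MvPolynomial (Fin n) ℝ)
      = ∑ s : Fin L, C (L : ℝ)⁻¹ * ∑ I : Fin L → Fin n, ∑ J : Fin L → Fin n, ∏ t, (C (kkm s t p (I t) (J t)) * (X (I t) * X (J t))) := by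
    simp_rw [h1, Finset.mul_sum]
    rw [Finset.sum_comm (s := (Finset.univ : Finset (Fin L)))]
    refine Finset.sum_congr rfl fun I _ => ?_
    rw [Finset.sum_comm]
  rw [h2]
  have h3 : ∀ s : Fin L, ∑ I : Fin L → Fin n, ∑ J : Fin L → Fin n, ∏ t, (C (kkm s t p (I t) (J t)) * (X (I t) * X (J t)) : MvPolynomial (Fin n) ℝ)
      = X p.1 * X p.2 * kkS n ^ (L - 1) := by
    intro s
    rw [kk_prodsum2 (fun t i j => (C (kkm s t p i j) * (X i * X j) : MvPolynomial (Fin n) ℝ))]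
    simp_rw [kkm_poly]
    rw [Finset.prod_ite, Finset.prod_const, Finset.prod_const]
    have c1 : (Finset.univ.filter fun t : Fin L => t = s).card = 1 := by
      simp [Finset.filter_eq']
    have c2 : (Finset.univ.filter fun t : Fin L => ¬ t = s).card = L - 1 := by
      simp [Finset.filter_ne']
    rw [c1, c2, pow_one]
  simp_rw [h3]
  rw [Finset.sum_const, Finset.card_univ, Fintype.card_fin, nsmul_eq_mul, ← mul_assoc]
  have : ((L : MvPolynomial (Fin n) ℝ) * C (L : ℝ)⁻¹) = 1 := by
    have : (L : MvPolynomial (Fin n) ℝ) = C (L : ℝ) := by simp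
    rw [this, ← map_mul, mul_inv_cancel₀ (by positivity), map_one]
  rw [this, one_mul]

open MvPolynomial in
theorem kkH_poly {n h L : ℕ} (hL : 0 < L) (p : Fin h → Fin n × Fin n) :
    ∑ I : Fin h → Fin L → Fin n, ∑ J : Fin h → Fin L → Fin n, (C (kkH p I J) * (kkmon I * kkmon J)) =
      (∏ j, (X (p j).1 * X (p j).2)) * kkS n ^ (h * (L - 1)) := by
  have h0 : ∑ I : Fin h → Fin L → Fin n, ∑ J : Fin h → Fin L → Fin n, (C (∏ j, kkg (p j) (I j) (J j)) * (kkmon I * kkmon J)) =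
      (∏ j, (X (p j).1 * X (p j).2)) * kkS n ^ (h * (L - 1)) := by
    have : ∀ I J : Fin h → Fin L → Fin n, (C (∏ j, kkg (p j) (I j) (J j)) * (kkmon I * kkmon J))
      = ∏ j, (C (kkg (p j) (I j) (J j)) * ((∏ t, X (I j t)) * (∏ t, X (J j t))) : MvPolynomial (Fin n) ℝ) := by
      intro I J
      simp only [kkmon, map_prod, Finset.prod_mul_distrib]
    simp_rw [this]
    rw [kk_prodsum2 (fun j (a b : Fin L → Fin n) => (C (kkg (p j) a b) * ((∏ t, X (a t)) * (∏ t, X (b t))) : MvPolynomial (Fin n) ℝ))]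
    simp_rw [kkg_poly hL]
    rw [Finset.prod_mul_distrib, Finset.prod_const, Finset.card_univ, Fintype.card_fin, ← pow_mul, mul_comm (L - 1)]
  have h1 : ∑ I : Fin h → Fin L → Fin n, ∑ J : Fin h → Fin L → Fin n, (C (∏ j, kkg (p j) (J j) (I j)) * (kkmon I * kkmon J)) =
      (∏ j, (X (p j).1 * X (p j).2)) * kkS n ^ (h * (L - 1)) := by
    rw [← h0, Finset.sum_comm]
    refine Finset.sum_congr rfl fun I _ => Finset.sum_congr rfl fun J _ => ?_
    rw [mul_comm (kkmon J)]
  have h2 : ∀ I J : Fin h → Fin L → Fin n, (C (kkH p I J) * (kkmon I * kkmon J))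
      = C (1/2) * (C (∏ j, kkg (p j) (I j) (J j)) * (kkmon I * kkmon J)) + C (1/2) * (C (∏ j, kkg (p j) (J j) (I j)) * (kkmon I * kkmon J)) := by
    intro I J
    simp only [kkH, Matrix.of_apply, map_mul, map_add]; ring
  simp_rw [h2, Finset.sum_add_distrib, ← Finset.mul_sum, h0, h1]
  rw [← add_mul, ← map_add]; norm_num

open MvPolynomial in
theorem kkmon_deg {n h L : ℕ} (I : Fin h → Fin L → Fin n) : (kkmon I).totalDegree ≤ h * L := by
  unfold kkmon
  refine (totalDegree_finsetProd _ _).trans ?_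
  calc _ ≤ ∑ j : Fin h, L := by
        refine Finset.sum_le_sum fun j _ => ?_
        refine (totalDegree_finsetProd _ _).trans ?_
        simp
    _ = _ := by simp

open MvPolynomial in
theorem kkS_deg (n r : ℕ) : (kkS n ^ r).totalDegree ≤ 2 * r := by
  refine (totalDegree_pow _ _).trans ?_
  rw [mul_comm]
  refine Nat.mul_le_mul_right _ ?_
  unfold kkS
  refine totalDegree_finsetSum_le fun i _ => ?_
  refine (totalDegree_pow _ _).trans ?_
  simp

open MvPolynomial in
theorem kkE_pow {n q : ℕ} (E : MvPolynomial (Fin n) ℝ →ₗ[ℝ] ℝ)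
    (hE : ∀ p : MvPolynomial (Fin n) ℝ, p.totalDegree ≤ q - 2 →
                E (p * ((∑ i, MvPolynomial.X i ^ 2) - 1)) = 0)
    (g : MvPolynomial (Fin n) ℝ) (r : ℕ) (hr : g.totalDegree + 2 * r ≤ q) :
    E (g * kkS n ^ r) = E g := by
  induction r with
  | zero => simp
  | succ r ih =>
    rw [← ih (by omega)]
    have := hE (g * kkS n ^ r) (by
      refine (totalDegree_mul _ _).trans ?_
      have := kkS_deg n r
      omega)
    rw [← kkS, mul_sub, mul_one, map_sub, sub_eq_zero] at this
    rw [← this, pow_succ, mul_assoc]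

open MvPolynomial in
theorem kkE_cert {n N : ℕ} {ι : Type*} [Fintype ι] [DecidableEq ι]
    (E : MvPolynomial (Fin n) ℝ →ₗ[ℝ] ℝ)
    (hE : ∀ p : MvPolynomial (Fin n) ℝ, p.totalDegree ≤ N → 0 ≤ E (p * p))
    (mon : ι → MvPolynomial (Fin n) ℝ) (hmon : ∀ I, (mon I).totalDegree ≤ N)
    (Y U : Matrix ι ι ℝ) (l : ι → ℝ) (t : ℝ) (hl : ∀ u, l u ≤ t) (hU : U * Uᵀ = 1)
    (hY : Y = U * diagonal l * Uᵀ) :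
    E (∑ I, ∑ J, C (Y I J) * (mon I * mon J)) ≤ t * E (∑ I, mon I * mon I) := by
  let p : ι → MvPolynomial (Fin n) ℝ := fun u => ∑ I, C (U I u) * mon I
  have hp : ∀ u, (p u).totalDegree ≤ N := by
    intro u
    refine totalDegree_finsetSum_le fun I _ => ?_
    refine (totalDegree_mul _ _).trans ?_
    simpa using hmon I
  have gen : ∀ k : ι → ℝ, ∑ I, ∑ J, C ((U * diagonal k * Uᵀ) I J) * (mon I * mon J)
      = ∑ u, C (k u) * (p u * p u) := by
    intro k
    have : ∀ I J, C ((U * diagonal k * Uᵀ) I J) * (mon I * mon J)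
        = ∑ u, C (k u) * ((C (U I u) * mon I) * (C (U J u) * mon J)) := by
      intro I J
      rw [mul_apply, map_sum, Finset.sum_mul]
      refine Finset.sum_congr rfl fun u _ => ?_
      rw [mul_diagonal, transpose_apply]; simp only [map_mul]; ring
    simp_rw [this]
    have e : ∀ u, C (k u) * (p u * p u) = ∑ I, ∑ J, C (k u) * ((C (U I u) * mon I) * (C (U J u) * mon J)) := by
      intro u
      simp only [p]
      rw [Finset.sum_mul_sum, Finset.mul_sum]
      simp_rw [Finset.mul_sum]
    simp_rw [e]
    rw [Finset.sum_comm (s := (Finset.univ : Finset ι)) (t := Finset.univ) (f := fun u I => ∑ J, C (k u) * ((C (U I u) * mon I) * (C (U J u) * mon J)))]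
    refine Finset.sum_congr rfl fun I _ => ?_
    rw [Finset.sum_comm]
  have g1 := gen l
  rw [← hY] at g1
  have g2 := gen (fun _ => 1)
  have d1 : (diagonal (fun _ : ι => (1:ℝ))) = 1 := diagonal_one
  rw [d1, Matrix.mul_one, hU] at g2
  have g3 : ∑ I, ∑ J, C ((1 : Matrix ι ι ℝ) I J) * (mon I * mon J) = ∑ I, mon I * mon I := by
    refine Finset.sum_congr rfl fun I _ => ?_
    rw [Finset.sum_eq_single I]
    · simp
    · intro b _ hb; simp [Matrix.one_apply, Ne.symm hb]
    · simp
  rw [g1, ← g3, g2, map_sum, map_sum, Finset.mul_sum]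
  refine Finset.sum_le_sum fun u _ => ?_
  rw [C_mul', C_mul', map_smul, map_smul, smul_eq_mul, smul_eq_mul, one_mul]
  exact mul_le_mul_of_nonneg_right (hl u) (hE _ (hp u))

/-! final assembly -/
def kkPair (n h : ℕ) : (Fin (h * 2) → Fin n) ≃ (Fin h → Fin n × Fin n) :=
  ((Equiv.arrowCongr finProdFinEquiv.symm (Equiv.refl (Fin n))).trans
    (Equiv.curry (Fin h) (Fin 2) (Fin n))).trans
    (Equiv.arrowCongr (Equiv.refl (Fin h)) (finTwoArrowEquiv (Fin n)))

open MvPolynomial in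
theorem kkPair_prod {n h : ℕ} (K : Fin (h * 2) → Fin n) :
    ∏ ℓ, (X (K ℓ) : MvPolynomial (Fin n) ℝ) =
      ∏ j, (X (kkPair n h K j).1 * X (kkPair n h K j).2) := by
  rw [← Equiv.prod_comp finProdFinEquiv, Fintype.prod_prod_type]
  refine Finset.prod_congr rfl fun j _ => ?_
  rw [Fin.prod_univ_two]
  rfl

theorem kkSgn_signT {n d : ℕ} (A : (Fin d → Fin n) → Bool) (K : Fin d → Fin n) :
    kkSgn (A K) = signT A K := rfl

theorem kk_good {n h L q m : ℕ} (hL : 0 < L) (hq : q = L * (h * 2)) (hm : m ≠ 0) (t : ℝ) (ht : 0 ≤ t)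
    (A : (Fin (h * 2) → Fin n) → Bool)
    (hA : trace (kkX (fun K => kkH (L := L) (kkPair n h K)) A ^ (2 * m)) ≤ t ^ (2 * m))
    (E : MvPolynomial (Fin n) ℝ →ₗ[ℝ] ℝ) (hE1 : E 1 = 1)
    (hE2 : ∀ p : MvPolynomial (Fin n) ℝ, p.totalDegree ≤ q / 2 → 0 ≤ E (p * p))
    (hE3 : ∀ p : MvPolynomial (Fin n) ℝ, p.totalDegree ≤ q - 2 →
                E (p * ((∑ i, MvPolynomial.X i ^ 2) - 1)) = 0) :
    E (∑ K : Fin (h * 2) → Fin n, MvPolynomial.C (signT A K) * ∏ ℓ, MvPolynomial.X (K ℓ)) ≤ t := by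
  set Y := kkX (fun K => kkH (L := L) (kkPair n h K)) A with hYdef
  have hYs : Yᵀ = Y := kkX_symm _ (fun K => kkH_symm _) A
  obtain ⟨U, l, hl, hU, hY⟩ := kk_cert Y hYs m hm t ht hA
  have hq2 : q / 2 = h * L := by
    rw [hq, ← mul_assoc, Nat.mul_div_cancel _ (by norm_num), mul_comm]
  have h1 := kkE_cert (N := q / 2) E hE2 (kkmon (n := n) (h := h) (L := L))
    (fun I => (kkmon_deg I).trans hq2.ge) Y U l t hl hU hY
  have hq3 : q = 2 * (h * L) := by rw [hq]; ring
  rw [kkmon_sq] at h1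
  have h2 := kkE_pow E hE3 1 (h * L) (by simp [hq3])
  rw [one_mul, hE1] at h2
  rw [h2, mul_one] at h1
  set f : MvPolynomial (Fin n) ℝ := ∑ K : Fin (h * 2) → Fin n, MvPolynomial.C (signT A K) * ∏ ℓ, MvPolynomial.X (K ℓ) with hf
  have hfd : f.totalDegree ≤ 2 * h := by
    rw [hf]
    refine MvPolynomial.totalDegree_finsetSum_le fun K _ => ?_
    refine (MvPolynomial.totalDegree_mul _ _).trans ?_
    rw [MvPolynomial.totalDegree_C, zero_add]
    refine (MvPolynomial.totalDegree_finsetProd _ _).trans ?_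
    simp [mul_comm]
  have h3 := kkE_pow E hE3 f (h * (L - 1)) (by
    obtain ⟨L', rfl⟩ : ∃ L', L = L' + 1 := ⟨L - 1, by omega⟩
    rw [Nat.add_sub_cancel, hq3]
    have : 2 * (h * (L' + 1)) = 2 * h + 2 * (h * L') := by ring
    omega)
  rw [← h3]
  refine le_trans (le_of_eq ?_) h1
  congr 1
  rw [hf, Finset.sum_mul]
  have e : ∀ I J, MvPolynomial.C (Y I J) * (kkmon I * kkmon J)
      = ∑ K, MvPolynomial.C (signT A K) * (MvPolynomial.C (kkH (L := L) (kkPair n h K) I J) * (kkmon I * kkmon J)) := by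
    intro I J
    rw [hYdef, kkX, Matrix.sum_apply, map_sum, Finset.sum_mul]
    refine Finset.sum_congr rfl fun K _ => ?_
    rw [Matrix.smul_apply, smul_eq_mul, map_mul, kkSgn_signT, mul_assoc]
  simp_rw [e]
  have e2 : ∀ I : Fin h → Fin L → Fin n, ∑ J, ∑ K, MvPolynomial.C (signT A K) * (MvPolynomial.C (kkH (L := L) (kkPair n h K) I J) * (kkmon I * kkmon J))
      = ∑ K, ∑ J, MvPolynomial.C (signT A K) * (MvPolynomial.C (kkH (L := L) (kkPair n h K) I J) * (kkmon I * kkmon J)) :=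
    fun I => Finset.sum_comm
  simp_rw [e2]
  rw [Finset.sum_comm]
  refine Finset.sum_congr rfl fun K _ => ?_
  simp_rw [← Finset.mul_sum]
  rw [kkH_poly hL, kkPair_prod, mul_assoc]

theorem kk_prob {n d m : ℕ} {ι : Type*} [Fintype ι] [DecidableEq ι]
    (H : (Fin d → Fin n) → Matrix ι ι ℝ) (hH : ∀ K, (H K)ᵀ = H K) (σ : ℝ) (hσ0 : 0 ≤ σ)
    (hσ : ∀ v : ι → ℝ, ∑ K, ∑ i, (∑ j, H K i j * v j) ^ 2 ≤ σ * ∑ j, v j ^ 2)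
    (t : ℝ) (ht : 0 < t) (htσ : Real.exp 1 ^ 2 * (4 * m * σ) ≤ t ^ 2) (δ : ℝ)
    (hδ : (Fintype.card ι : ℝ) ≤ δ * Real.exp 1 ^ (2 * m))
    (P : ((Fin d → Fin n) → ℝ) → Prop)
    (hP : ∀ A : (Fin d → Fin n) → Bool, trace (kkX H A ^ (2 * m)) ≤ t ^ (2 * m) → P (signT A)) :
    1 - δ ≤ tprob n d P := by
  classical
  unfold tprob
  have hc : (0:ℝ) < (Fintype.card ((Fin d → Fin n) → Bool) : ℝ) := by
    exact_mod_cast Fintype.card_pos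
  rw [le_div_iff₀ hc, Nat.card_eq_fintype_card, Fintype.card_subtype]
  set N : ℝ := (Fintype.card ((Fin d → Fin n) → Bool) : ℝ) with hN
  have hsplit : ((Finset.univ.filter fun A : (Fin d → Fin n) → Bool => P (signT A)).card : ℝ)
      + ((Finset.univ.filter fun A : (Fin d → Fin n) → Bool => ¬ P (signT A)).card : ℝ) = N := by
    rw [hN, ← Finset.card_univ]
    exact_mod_cast Finset.card_filter_add_card_filter_not (fun A : (Fin d → Fin n) → Bool => P (signT A))
  set b : ℝ := ((Finset.univ.filter fun A : (Fin d → Fin n) → Bool => ¬ P (signT A)).card : ℝ) with hb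
  have hmk : b * t ^ (2 * m) ≤ ∑ A : (Fin d → Fin n) → Bool, trace (kkX H A ^ (2 * m)) := by
    calc b * t ^ (2 * m) = ∑ A ∈ Finset.univ.filter (fun A : (Fin d → Fin n) → Bool => ¬ P (signT A)), t ^ (2 * m) := by
          rw [Finset.sum_const, nsmul_eq_mul]
      _ ≤ ∑ A ∈ Finset.univ.filter (fun A : (Fin d → Fin n) → Bool => ¬ P (signT A)), trace (kkX H A ^ (2 * m)) := by
          refine Finset.sum_le_sum fun A hA => ?_
          have hA := (Finset.mem_filter.1 hA).2
          by_contra hcon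
          exact hA (hP A (le_of_lt (not_le.1 hcon)))
      _ ≤ _ := by
          refine Finset.sum_le_sum_of_subset_of_nonneg (Finset.filter_subset _ _) fun A _ _ => ?_
          exact kk_trace_nonneg _ (kkX_symm H hH A) m
  have hmom := kk_moment H hH σ hσ0 hσ m m le_rfl
  have h1 : b * t ^ (2 * m) ≤ (4 * m * σ) ^ m * (N * (δ * Real.exp 1 ^ (2 * m))) := by
    refine hmk.trans (hmom.trans ?_)
    gcongr
  have h2 : (4 * m * σ) ^ m * Real.exp 1 ^ (2 * m) ≤ t ^ (2 * m) := by
    rw [pow_mul, pow_mul, ← mul_pow]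
    refine pow_le_pow_left₀ (by positivity) ?_ m
    linarith
  have hδ0 : 0 ≤ δ := by
    by_contra hcon
    have : δ * Real.exp 1 ^ (2 * m) < 0 := mul_neg_of_neg_of_pos (not_le.1 hcon) (by positivity)
    have : (0:ℝ) ≤ Fintype.card ι := by positivity
    linarith
  have h3 : b * t ^ (2 * m) ≤ (N * δ) * t ^ (2 * m) := by
    refine h1.trans ?_
    calc _ = (N * δ) * ((4 * m * σ) ^ m * Real.exp 1 ^ (2 * m)) := by ring
      _ ≤ _ := by gcongr
  have h4 : b ≤ N * δ := le_of_mul_le_mul_right h3 (by positivity)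
  linarith

theorem kk_num {n h L m : ℕ} (hh : 0 < h) (hL : 0 < L) (hn : 3 ≤ n) (hqn : L * (h * 2) ≤ n)
    (hlog : 1 ≤ Real.log n) (hm : (m : ℝ) ≤ 2 * ((h * L : ℕ) : ℝ) * Real.log n) :
    Real.exp 1 ^ 2 * (4 * m * ((n : ℝ) / L + 1) ^ h) ≤
      ((2 * Real.exp 1 * (4 * h) ^ h) * (n : ℝ) ^ (((h * 2 : ℕ) : ℝ) / 4) * Real.log n ^ (((h * 2 : ℕ) : ℝ) + 1 / 2) /
                  ((L * (h * 2) : ℕ) : ℝ) ^ (((h * 2 : ℕ) : ℝ) / 4 - 1 / 2)) ^ 2 := by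
  set q : ℝ := ((L * (h * 2) : ℕ) : ℝ) with hq
  have hq0 : 0 < q := by rw [hq]; exact_mod_cast (by positivity)
  have hn0 : (0:ℝ) < n := by exact_mod_cast (by omega : 0 < n)
  have hL0 : (0:ℝ) < L := by exact_mod_cast hL
  have hh0 : (1:ℝ) ≤ h := by exact_mod_cast hh
  have hl0 : 0 < Real.log n := by linarith
  have hLn : (L : ℝ) ≤ n := by
    have : L ≤ L * (h * 2) := Nat.le_mul_of_pos_right _ (by omega)
    exact_mod_cast this.trans hqn
  have ha : ((n : ℝ) ^ (((h * 2 : ℕ) : ℝ) / 4)) ^ 2 = (n : ℝ) ^ h := by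
    rw [← Real.rpow_natCast ((n : ℝ) ^ _) 2, ← Real.rpow_mul hn0.le, ← Real.rpow_natCast]
    congr 1; push_cast; ring
  have hb : Real.log n ≤ (Real.log n ^ (((h * 2 : ℕ) : ℝ) + 1 / 2)) ^ 2 := by
    rw [← Real.rpow_natCast (Real.log n ^ _) 2, ← Real.rpow_mul hl0.le]
    conv_lhs => rw [← Real.rpow_one (Real.log n)]
    refine Real.rpow_le_rpow_of_exponent_le hlog ?_
    push_cast; linarith
  have hc : (q ^ (((h * 2 : ℕ) : ℝ) / 4 - 1 / 2)) ^ 2 = q ^ h / q := by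
    rw [← Real.rpow_natCast (q ^ _) 2, ← Real.rpow_mul hq0.le, ← Real.rpow_natCast q h]
    conv_rhs => rw [← Real.rpow_one q, Real.rpow_one (q), ← Real.rpow_sub_one hq0.ne']
    congr 1; push_cast; ring
  rw [div_pow, mul_pow, mul_pow, ha, hc]
  set b2 := (Real.log n ^ (((h * 2 : ℕ) : ℝ) + 1 / 2)) ^ 2 with hb2
  have hm' : (m : ℝ) ≤ q * Real.log n := by
    refine hm.trans (le_of_eq ?_); rw [hq]; push_cast; ring
  have hs : ((n : ℝ) / L + 1) ^ h ≤ (4 * h) ^ h * (n : ℝ) ^ h / q ^ h := by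
    rw [← mul_pow, ← div_pow]
    refine pow_le_pow_left₀ (by positivity) ?_ h
    have : 4 * (h : ℝ) * n / q = 2 * (n / L) := by
      rw [hq]; push_cast; field_simp; ring
    rw [this]
    have : 1 ≤ (n : ℝ) / L := by rw [le_div_iff₀ hL0]; linarith
    linarith
  have hC : ((4 : ℝ) * h) ^ h ≤ ((4 * h) ^ h) ^ 2 := by
    have : (1:ℝ) ≤ (4 * h) ^ h := one_le_pow₀ (by linarith)
    nlinarith
  calc Real.exp 1 ^ 2 * (4 * m * ((n : ℝ) / L + 1) ^ h)
      ≤ Real.exp 1 ^ 2 * (4 * (q * b2) * (((4 * h) ^ h) ^ 2 * (n : ℝ) ^ h / q ^ h)) := by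
        have : (m : ℝ) ≤ q * b2 := hm'.trans (by gcongr)
        have hs' : ((n : ℝ) / L + 1) ^ h ≤ ((4 * h) ^ h) ^ 2 * (n : ℝ) ^ h / q ^ h := hs.trans (by gcongr)
        gcongr
    _ = _ := by field_simp; ring

end KK

theorem stmt_2 (d : ℕ) (hd2 : 2 ≤ d) (hde : d % 2 = 0) :
    ∃ C c : ℝ, 0 < C ∧ 0 < c ∧
      ∀ n q k : ℕ, 3 ≤ n → 1 ≤ k → q = 2 ^ k * d → q ≤ n →
        1 - (n : ℝ) ^ (-c) ≤
          tprob n d (fun A =>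
            ∀ E : MvPolynomial (Fin n) ℝ →ₗ[ℝ] ℝ,
              E 1 = 1 →
              (∀ p : MvPolynomial (Fin n) ℝ, p.totalDegree ≤ q / 2 → 0 ≤ E (p * p)) →
              (∀ p : MvPolynomial (Fin n) ℝ, p.totalDegree ≤ q - 2 →
                E (p * ((∑ i, MvPolynomial.X i ^ 2) - 1)) = 0) →
              E (∑ K : Fin d → Fin n, MvPolynomial.C (A K) * ∏ ℓ, MvPolynomial.X (K ℓ)) ≤
                C * (n : ℝ) ^ ((d : ℝ) / 4) * Real.log n ^ ((d : ℝ) + 1 / 2) /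
                  (q : ℝ) ^ ((d : ℝ) / 4 - 1 / 2)) := by
  obtain ⟨h, rfl⟩ : ∃ h, d = h * 2 := ⟨d / 2, by omega⟩
  have hh : 0 < h := by omega
  refine ⟨2 * Real.exp 1 * (4 * h) ^ h, 1, by positivity, one_pos, ?_⟩
  intro n q k hn hk hq hqn
  subst hq
  have hL : 0 < 2 ^ k := by positivity
  generalize 2 ^ k = L at hL hqn ⊢
  have hn0 : (0:ℝ) < n := by exact_mod_cast (by omega : 0 < n)
  have hlog : 1 ≤ Real.log n := by
    rw [Real.le_log_iff_exp_le hn0]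
    have h3 : (3:ℝ) ≤ n := by exact_mod_cast hn
    have := Real.exp_one_lt_d9
    linarith
  have hhL : 1 ≤ h * L := Nat.mul_pos hh hL
  have hhL' : (1:ℝ) ≤ ((h * L : ℕ) : ℝ) := by exact_mod_cast hhL
  obtain ⟨m, hm⟩ : ∃ m : ℕ, m = ⌈((h * L : ℕ) : ℝ) * Real.log n⌉₊ := ⟨_, rfl⟩
  have hprod : 1 ≤ ((h * L : ℕ) : ℝ) * Real.log n := by nlinarith
  have hm1 : ((h * L : ℕ) : ℝ) * Real.log n ≤ m := by rw [hm]; exact Nat.le_ceil _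
  have hm2 : (m : ℝ) ≤ 2 * ((h * L : ℕ) : ℝ) * Real.log n := by
    have := Nat.ceil_lt_add_one (a := ((h * L : ℕ) : ℝ) * Real.log n) (by linarith)
    rw [← hm] at this
    linarith
  have hm0 : m ≠ 0 := by
    rintro rfl
    push_cast at hm1 hprod; linarith
  have hq0 : (0:ℝ) < ((L * (h * 2) : ℕ) : ℝ) := by exact_mod_cast (by positivity)
  have hnum := kk_num hh hL hn hqn hlog hm2
  set t := ((2 * Real.exp 1 * (4 * (h:ℝ)) ^ h) * (n : ℝ) ^ (((h * 2 : ℕ) : ℝ) / 4) * Real.log n ^ (((h * 2 : ℕ) : ℝ) + 1 / 2) /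
                  ((L * (h * 2) : ℕ) : ℝ) ^ (((h * 2 : ℕ) : ℝ) / 4 - 1 / 2)) with ht
  have ht0 : 0 < t := by
    have hl0 : 0 < Real.log n := by linarith
    have hh0 : (0:ℝ) < h := by exact_mod_cast hh
    rw [ht]
    have a1 := Real.rpow_pos_of_pos hn0 (((h * 2 : ℕ) : ℝ) / 4)
    have a2 := Real.rpow_pos_of_pos hl0 (((h * 2 : ℕ) : ℝ) + 1 / 2)
    have a3 := Real.rpow_pos_of_pos hq0 (((h * 2 : ℕ) : ℝ) / 4 - 1 / 2)
    have a4 : 0 < 2 * Real.exp 1 * (4 * (h:ℝ)) ^ h := by positivity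
    exact div_pos (mul_pos (mul_pos a4 a1) a2) a3
  refine kk_prob (m := m) (fun K => kkH (L := L) (kkPair n h K)) (fun K => kkH_symm _)
    (((n : ℝ) / L + 1) ^ h) (by positivity) ?_ t ht0 hnum _ ?_ _ ?_
  · intro v
    refine le_trans (le_of_eq ?_) (kkH_norm hL v)
    exact Equiv.sum_comp (kkPair n h) (fun p => ∑ I, (∑ J, kkH p I J * v J) ^ 2)
  · have e1 : (Fintype.card (Fin h → Fin L → Fin n) : ℝ) = (n : ℝ) ^ (h * L) := by
      simp [← pow_mul, mul_comm]
    have e2 : (n : ℝ) ^ (h * L) ≤ Real.exp m := by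
      rw [← Real.exp_log hn0, ← Real.exp_nat_mul]
      exact Real.exp_le_exp.2 hm1
    have e3 : (n : ℝ) ≤ Real.exp m := by
      refine le_trans ?_ e2
      exact le_self_pow₀ (by exact_mod_cast (by omega : 1 ≤ n)) (by omega)
    have e4 : Real.exp 1 ^ (2 * m) = Real.exp m * Real.exp m := by
      rw [← Real.exp_nat_mul, ← Real.exp_add]; congr 1; push_cast; ring
    rw [e1, e4, Real.rpow_neg_one]
    calc (n : ℝ) ^ (h * L) ≤ Real.exp m := e2
      _ = (n : ℝ)⁻¹ * (n * Real.exp m) := by field_simp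
      _ ≤ _ := by gcongr
  · intro A hA E hE1 hE2 hE3
    exact kk_good hL rfl hm0 t ht0.le A hA E hE1 hE2 hE3
end
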